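/- arXiv:1604.08435 — 3 statements merged into one kernel-verified Lean document; each statement's English description precedes it below -/
import Mathlib

section
/- Let k be an algebraically closed field of characteristic p ≥ 5 and R = k[U,V,W]/(U²+V³+W⁴) (type E₆). Then the Hilbert–Kunz function of R is HKF(R,p^e) = (2 - 1/24)·p^{2e} - 23/24 for all e ≥ 0; if instead p ∈ {2,3}, then HKF(R,p^e) = 2·p^{2e} for all e ≥ 1. -/
open MvPolynomial

noncomputable section

/-- The defining ideal of the `E₆` surface ring `k[U,V,W]/(U²+V³+W⁴)`. -/
def e6Rel (k : Type*) [Field k] : Ideal (MvPolynomial (Fin 3) k) :=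
  Ideal.span {X 0 ^ 2 + X 1 ^ 3 + X 2 ^ 4}

/-- If `M` is symmetric, couples only indices of opposite weight, and is injective on vectors
supported in nonpositive weights, then its nullity is the number of positive indices minus the
number of negative ones. -/
theorem finrank_ker_of_opposite_weights {k ι : Type*} [Field k] [Fintype ι]
    (M : Matrix ι ι k) (w : ι → ℤ) (hsymm : ∀ i j, M i j = M j i)
    (hw : ∀ i j, M i j ≠ 0 → w i + w j = 0)
    (hinj : ∀ v : ι → k, (∀ i, 0 < w i → v i = 0) → M.mulVec v = 0 → v = 0) :
    Module.finrank k (LinearMap.ker M.mulVecLin) + Fintype.card {i // w i < 0} =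
      Fintype.card {i // 0 < w i} := by
  classical
  set B : Matrix {i // w i < 0} {i // 0 < w i} k := M.submatrix (↑) (↑) with hB
  have hBinj : Function.Injective B.transpose.mulVecLin := by
    rw [← LinearMap.ker_eq_bot, LinearMap.ker_eq_bot']
    intro v hv
    let v' : ι → k := fun i => if h : w i < 0 then v ⟨i, h⟩ else 0
    have hv' : v' = 0 := by
      apply hinj
      · intro i hi
        simp [v', hi.le]
      · ext i
        by_cases hi : 0 < w i
        · have := congrFun hv ⟨i, hi⟩
          simp only [Matrix.mulVecLin_apply, Matrix.mulVec, dotProduct, Matrix.transpose_apply,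
            Pi.zero_apply, hB, Matrix.submatrix_apply] at this ⊢
          rw [← this, ← Finset.sum_subset (Finset.subset_univ (Finset.univ.filter (w · < 0)))]
          · rw [← Finset.sum_subtype_eq_sum_filter]
            simp only [Finset.subtype_univ]
            refine Finset.sum_congr rfl fun j _ => ?_
            simp [v', j.2, hsymm i j]
          · intro j _ hj
            simp only [Finset.mem_filter, Finset.mem_univ, true_and] at hj
            simp [v', hj]
        · simp only [Matrix.mulVec, dotProduct, Pi.zero_apply]
          refine Finset.sum_eq_zero fun j _ => ?_
          by_cases hM : M i j = 0
          · simp [hM]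
          · have := hw i j hM
            have : ¬ w j < 0 := by omega
            simp [v', this]
    ext ⟨i, hi⟩
    have := congrFun hv' i
    simpa [v', hi] using this
  have hrank : Module.finrank k (LinearMap.range B.mulVecLin) = Fintype.card {i // w i < 0} := by
    change B.rank = _
    rw [← Matrix.rank_transpose, Matrix.rank, LinearMap.finrank_range_of_inj hBinj]
    simp
  have hnull := LinearMap.finrank_range_add_finrank_ker B.mulVecLin
  rw [hrank, Module.finrank_fintype_fun_eq_card] at hnull
  rw [← hnull, add_comm]
  congr 1
  have hsupp : ∀ v, M.mulVec v = 0 → ∀ i, w i ≤ 0 → v i = 0 := by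
    intro v hv
    have h0 : (fun i => if 0 < w i then 0 else v i) = 0 := by
      apply hinj
      · intro i hi
        simp [hi]
      · ext i
        by_cases hi : 0 ≤ w i
        · rw [← hv]
          simp only [Matrix.mulVec, dotProduct]
          refine Finset.sum_congr rfl fun j _ => ?_
          by_cases hM : M i j = 0
          · simp [hM]
          · have := hw i j hM
            have : ¬ 0 < w j := by omega
            simp [this]
        · simp only [Matrix.mulVec, dotProduct, Pi.zero_apply]
          refine Finset.sum_eq_zero fun j _ => ?_
          by_cases hM : M i j = 0
          · simp [hM]
          · have := hw i j hM
            have : 0 < w j := by omega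
            simp [this]
    intro i hi
    have := congrFun h0 i
    simpa [hi.not_gt] using this
  have hrestr : ∀ v : ι → k, (∀ i, w i ≤ 0 → v i = 0) → ∀ i,
      M.mulVec v i = ∑ j : {j // 0 < w j}, M i j * v j := by
    intro v hv i
    simp only [Matrix.mulVec, dotProduct]
    rw [← Finset.sum_subset (Finset.subset_univ (Finset.univ.filter (0 < w ·)))]
    · rw [← Finset.sum_subtype_eq_sum_filter]
      simp only [Finset.subtype_univ]
    · intro j _ hj
      simp only [Finset.mem_filter, Finset.mem_univ, true_and, not_lt] at hj
      simp [hv j hj]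
  refine LinearEquiv.finrank_eq (LinearEquiv.ofBijective
    ((LinearMap.funLeft k k ((↑) : {i // 0 < w i} → ι)).restrict
      (p := LinearMap.ker M.mulVecLin) (q := LinearMap.ker B.mulVecLin) ?_) ⟨?_, ?_⟩)
  · intro v hv
    simp only [LinearMap.mem_ker, Matrix.mulVecLin_apply] at hv ⊢
    ext i
    have := hrestr v (hsupp v hv) i
    rw [hv] at this
    simpa [Matrix.mulVec, dotProduct, hB] using this.symm
  · rintro ⟨v, hv⟩ ⟨v', hv'⟩ h
    have h := congrArg Subtype.val h
    simp only [LinearMap.mem_ker, Matrix.mulVecLin_apply] at hv hv'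
    ext i
    by_cases hi : 0 < w i
    · exact congrFun h ⟨i, hi⟩
    · simp only
      rw [hsupp v hv i (not_lt.1 hi), hsupp v' hv' i (not_lt.1 hi)]
  · rintro ⟨u, hu⟩
    simp only [LinearMap.mem_ker, Matrix.mulVecLin_apply] at hu
    let v : ι → k := fun i => if h : 0 < w i then u ⟨i, h⟩ else 0
    have hv : ∀ i, w i ≤ 0 → v i = 0 := fun i hi => by simp [v, hi.not_gt]
    refine ⟨⟨v, ?_⟩, ?_⟩
    · simp only [LinearMap.mem_ker, Matrix.mulVecLin_apply]
      ext i
      rw [hrestr v hv i]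
      by_cases hi : w i < 0
      · have := congrFun hu ⟨i, hi⟩
        simp only [Matrix.mulVec, dotProduct, hB, Matrix.submatrix_apply, Pi.zero_apply] at this ⊢
        rw [← this]
        refine Finset.sum_congr rfl fun j _ => ?_
        simp [v, j.2]
      · refine Finset.sum_eq_zero fun j _ => ?_
        have : M i j = 0 := by
          by_contra hM
          have := hw i j hM
          have := j.2
          omega
        simp [this]
    · ext i
      simp [v, i.2, LinearMap.funLeft]

/-- If `ρ : P → Q` factors through a surjection `T : P → E` onto a finite-dimensional space, then
`dim Q = dim E - dim T (ker ρ)`. -/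
theorem finrank_add_finrank_map_ker {k P Q E : Type*} [Field k] [AddCommGroup P] [Module k P]
    [AddCommGroup Q] [Module k Q] [AddCommGroup E] [Module k E] [FiniteDimensional k E]
    (ρ : P →ₗ[k] Q) (hρ : Function.Surjective ρ) (T : P →ₗ[k] E) (hT : Function.Surjective T)
    (hker : LinearMap.ker T ≤ LinearMap.ker ρ) :
    Module.finrank k Q + Module.finrank k ((LinearMap.ker ρ).map T) = Module.finrank k E := by
  obtain ⟨s, hs⟩ := T.exists_rightInverse_of_surjective (LinearMap.range_eq_top.2 hT)
  have hsT : ∀ x, ρ (s (T x)) = ρ x := fun x => by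
    rw [← sub_eq_zero, ← map_sub]
    apply hker
    have : T (s (T x)) = T x := LinearMap.congr_fun hs (T x)
    simp [this]
  have hsurj : Function.Surjective (ρ ∘ₗ s) := fun y => by
    obtain ⟨x, rfl⟩ := hρ y
    exact ⟨T x, hsT x⟩
  have hk : LinearMap.ker (ρ ∘ₗ s) = (LinearMap.ker ρ).map T := by
    ext y
    constructor
    · intro hy
      exact ⟨s y, hy, LinearMap.congr_fun hs y⟩
    · rintro ⟨x, hx, rfl⟩
      simpa [hsT x] using hx
  rw [← hk, ← LinearMap.finrank_range_add_finrank_ker (ρ ∘ₗ s),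
    LinearMap.range_eq_top.2 hsurj, finrank_top]

/-- The coefficient of `U V^(q-1) W^(q-1)` in the normal form of `U^a V^b W^c` modulo
`(U²+V³+W⁴, V^q, W^q)`. -/
def socleCoeff (k : Type*) [Field k] (q : ℕ) : ℕ → ℕ → ℕ → k
  | 0, _, _ => 0
  | 1, b, c => if b + 1 = q ∧ c + 1 = q then 1 else 0
  | a + 2, b, c => -socleCoeff k q a (b + 3) c - socleCoeff k q a b (c + 4)

theorem socleCoeff_eq_zero_of_weight {k : Type*} [Field k] {q : ℕ} : ∀ {a b c : ℕ},
    6 * a + 4 * b + 3 * c + 1 ≠ 7 * q → socleCoeff k q a b c = 0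
  | 0, _, _, _ => rfl
  | 1, b, c, h => by
    rw [socleCoeff, if_neg]
    omega
  | a + 2, b, c, h => by
    rw [socleCoeff, socleCoeff_eq_zero_of_weight (by omega),
      socleCoeff_eq_zero_of_weight (by omega)]
    simp

theorem socleCoeff_eq_zero_of_le {k : Type*} [Field k] {q : ℕ} : ∀ {a b c : ℕ},
    q ≤ b ∨ q ≤ c → socleCoeff k q a b c = 0
  | 0, _, _, _ => rfl
  | 1, b, c, h => by
    rw [socleCoeff, if_neg]
    omega
  | a + 2, b, c, h => by
    rw [socleCoeff, socleCoeff_eq_zero_of_le (by omega), socleCoeff_eq_zero_of_le (by omega)]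
    simp

/-- The monomial `U^a V^b W^c`. -/
def mon (k : Type*) [Field k] (a b c : ℕ) : MvPolynomial (Fin 3) k :=
  X 0 ^ a * X 1 ^ b * X 2 ^ c

theorem mon_mul_mon (k : Type*) [Field k] (a b c a' b' c' : ℕ) :
    mon k a b c * mon k a' b' c' = mon k (a + a') (b + b') (c + c') := by
  simp only [mon]
  ring

theorem monomial_eq_mon (k : Type*) [Field k] (m : Fin 3 →₀ ℕ) :
    (monomial m 1 : MvPolynomial (Fin 3) k) = mon k (m 0) (m 1) (m 2) := by
  rw [monomial_eq, Finsupp.prod_fintype _ _ (by simp), Fin.prod_univ_three]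
  simp [mon]

/-- The linear functional on `k[U,V,W]` with values `socleCoeff` on monomials. -/
def socleForm (k : Type*) [Field k] (q : ℕ) : MvPolynomial (Fin 3) k →ₗ[k] k :=
  (basisMonomials (Fin 3) k).constr k fun m => socleCoeff k q (m 0) (m 1) (m 2)

theorem socleForm_mon (k : Type*) [Field k] (q a b c : ℕ) :
    socleForm k q (mon k a b c) = socleCoeff k q a b c := by
  let m : Fin 3 →₀ ℕ := Finsupp.equivFunOnFinite.symm ![a, b, c]
  have h : mon k a b c = basisMonomials (Fin 3) k m := by
    simp only [coe_basisMonomials, monomial_eq_mon]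
    rfl
  rw [h, socleForm, Module.Basis.constr_basis]
  rfl

theorem linearMap_eq_of_mon {k M : Type*} [Field k] [AddCommGroup M] [Module k M]
    {f g : MvPolynomial (Fin 3) k →ₗ[k] M} (h : ∀ a b c, f (mon k a b c) = g (mon k a b c)) :
    f = g := by
  refine (basisMonomials (Fin 3) k).ext fun m => ?_
  simp only [coe_basisMonomials, monomial_eq_mon, h]

/-- The ideal `(U²+V³+W⁴, V^q, W^q)` of `k[U,V,W]`. -/
def parameterIdeal (k : Type*) [Field k] (q : ℕ) : Ideal (MvPolynomial (Fin 3) k) :=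
  Ideal.span {X 0 ^ 2 + X 1 ^ 3 + X 2 ^ 4, X 1 ^ q, X 2 ^ q}

theorem mem_parameterIdeal {k : Type*} [Field k] {q : ℕ} {x : MvPolynomial (Fin 3) k} :
    x ∈ parameterIdeal k q ↔ ∃ a b c,
      a * (X 0 ^ 2 + X 1 ^ 3 + X 2 ^ 4) + b * X 1 ^ q + c * X 2 ^ q = x := by
  simp [parameterIdeal, Submodule.mem_span_triple]

theorem socleForm_eq_zero {k : Type*} [Field k] {q : ℕ} {x : MvPolynomial (Fin 3) k}
    (hx : x ∈ parameterIdeal k q) : socleForm k q x = 0 := by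
  obtain ⟨a, b, c, rfl⟩ := mem_parameterIdeal.1 hx
  have h₁ : socleForm k q ∘ₗ LinearMap.mulRight k (X 0 ^ 2 + X 1 ^ 3 + X 2 ^ 4) = 0 := by
    refine linearMap_eq_of_mon fun a b c => ?_
    have : mon k a b c * (X 0 ^ 2 + X 1 ^ 3 + X 2 ^ 4) =
        mon k (a + 2) b c + mon k a (b + 3) c + mon k a b (c + 4) := by
      simp only [mon]
      ring
    simp only [LinearMap.comp_apply, LinearMap.mulRight_apply, this, map_add, socleForm_mon,
      socleCoeff, LinearMap.zero_apply]
    ring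
  have h₂ : socleForm k q ∘ₗ LinearMap.mulRight k (X 1 ^ q) = 0 := by
    refine linearMap_eq_of_mon fun a b c => ?_
    have : mon k a b c * X 1 ^ q = mon k a (b + q) c := by
      simp only [mon]
      ring
    simp only [LinearMap.comp_apply, LinearMap.mulRight_apply, this, socleForm_mon,
      LinearMap.zero_apply]
    exact socleCoeff_eq_zero_of_le (by omega)
  have h₃ : socleForm k q ∘ₗ LinearMap.mulRight k (X 2 ^ q) = 0 := by
    refine linearMap_eq_of_mon fun a b c => ?_
    have : mon k a b c * X 2 ^ q = mon k a b (c + q) := by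
      simp only [mon]
      ring
    simp only [LinearMap.comp_apply, LinearMap.mulRight_apply, this, socleForm_mon,
      LinearMap.zero_apply]
    exact socleCoeff_eq_zero_of_le (by omega)
  have e₁ := LinearMap.congr_fun h₁ a
  have e₂ := LinearMap.congr_fun h₂ b
  have e₃ := LinearMap.congr_fun h₃ c
  simp only [LinearMap.comp_apply, LinearMap.mulRight_apply, LinearMap.zero_apply] at e₁ e₂ e₃
  rw [map_add, map_add, e₁, e₂, e₃]
  simp

/-- The standard monomial `U^ε V^i W^j` with `ε < 2` and `i, j < q`. -/
def stdMon (k : Type*) [Field k] (q : ℕ) (β : Fin 2 × Fin q × Fin q) : MvPolynomial (Fin 3) k :=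
  mon k β.1 β.2.1 β.2.2

/-- The polynomial with given coefficients on the standard monomials. -/
def stdSum (k : Type*) [Field k] (q : ℕ) :
    (Fin 2 × Fin q × Fin q → k) →ₗ[k] MvPolynomial (Fin 3) k :=
  Fintype.linearCombination k (stdMon k q)

theorem exists_sub_stdSum_mem {k : Type*} [Field k] {q : ℕ} (x : MvPolynomial (Fin 3) k) :
    ∃ v, x - stdSum k q v ∈ parameterIdeal k q := by
  set N := (parameterIdeal k q).restrictScalars k ⊔ LinearMap.range (stdSum k q) with hN
  have hI : ∀ y ∈ parameterIdeal k q, y ∈ N := fun y hy => Submodule.mem_sup_left hy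
  have hmon : ∀ a b c, mon k a b c ∈ N := by
    intro a
    induction a using Nat.strong_induction_on with
    | _ a ih =>
      intro b c
      rcases Nat.lt_or_ge a 2 with ha | ha
      · rcases Nat.lt_or_ge b q with hb | hb
        · rcases Nat.lt_or_ge c q with hc | hc
          · refine Submodule.mem_sup_right
              ⟨Pi.single ((⟨a, ha⟩, ⟨b, hb⟩, ⟨c, hc⟩) : Fin 2 × Fin q × Fin q) 1, ?_⟩
            simp [stdSum, stdMon]
          · refine hI _ (mem_parameterIdeal.2 ⟨0, 0, mon k a b (c - q), ?_⟩)
            conv_rhs => rw [← Nat.sub_add_cancel hc]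
            simp only [mon]
            ring
        · refine hI _ (mem_parameterIdeal.2 ⟨0, mon k a (b - q) c, 0, ?_⟩)
          conv_rhs => rw [← Nat.sub_add_cancel hb]
          simp only [mon]
          ring
      · obtain ⟨a, rfl⟩ := Nat.exists_eq_add_of_le' ha
        have : mon k (a + 2) b c = mon k a b c * (X 0 ^ 2 + X 1 ^ 3 + X 2 ^ 4) -
            mon k a (b + 3) c - mon k a b (c + 4) := by
          simp only [mon]
          ring
        rw [this]
        refine N.sub_mem (N.sub_mem (hI _ (mem_parameterIdeal.2 ⟨mon k a b c, 0, 0, ?_⟩))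
          (ih a (by omega) _ _)) (ih a (by omega) _ _)
        ring
  have hx : x ∈ N := by
    have h : N.mkQ = 0 := linearMap_eq_of_mon fun a b c => by simpa using hmon a b c
    simpa using LinearMap.congr_fun h x
  obtain ⟨y, hy, z, ⟨v, rfl⟩, rfl⟩ := Submodule.mem_sup.1 hx
  exact ⟨v, by simpa using hy⟩

/-- The pairing of a polynomial with the standard monomials under `socleForm`. -/
def soclePairing (k : Type*) [Field k] (q : ℕ) :
    MvPolynomial (Fin 3) k →ₗ[k] (Fin 2 × Fin q × Fin q → k) :=
  LinearMap.pi fun γ => socleForm k q ∘ₗ LinearMap.mulRight k (stdMon k q γ)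

theorem soclePairing_apply {k : Type*} [Field k] {q : ℕ} (x : MvPolynomial (Fin 3) k)
    (γ : Fin 2 × Fin q × Fin q) :
    soclePairing k q x γ = socleForm k q (x * stdMon k q γ) := rfl

theorem soclePairing_eq_zero {k : Type*} [Field k] {q : ℕ} {x : MvPolynomial (Fin 3) k}
    (hx : x ∈ parameterIdeal k q) : soclePairing k q x = 0 := by
  ext γ
  exact socleForm_eq_zero (Ideal.mul_mem_right _ _ hx)

/-- The complementary standard monomial `U^(1-ε) V^(q-1-i) W^(q-1-j)`. -/
def dualIndex {q : ℕ} (β : Fin 2 × Fin q × Fin q) : Fin 2 × Fin q × Fin q :=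
  (β.1.rev, β.2.1.rev, β.2.2.rev)

theorem soclePairing_dual {k : Type*} [Field k] {q : ℕ} (β : Fin 2 × Fin q × Fin q) :
    soclePairing k q (stdMon k q (dualIndex β)) = Pi.single β 1 := by
  ext γ
  rw [soclePairing_apply, stdMon, stdMon, mon_mul_mon, socleForm_mon, Pi.single_apply]
  obtain ⟨ε, i, j⟩ := β
  obtain ⟨ε', i', j'⟩ := γ
  simp only [dualIndex, Prod.mk.injEq, Fin.val_rev, Fin.ext_iff]
  have hi := i.2
  have hj := j.2
  fin_cases ε <;> fin_cases ε' <;> simp [socleCoeff]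
  all_goals congr 1
  all_goals simp only [eq_iff_iff]
  all_goals omega

theorem soclePairing_surjective (k : Type*) [Field k] (q : ℕ) :
    Function.Surjective (soclePairing k q) := by
  rw [← LinearMap.range_eq_top, eq_top_iff, ← (Pi.basisFun k (Fin 2 × Fin q × Fin q)).span_eq,
    Submodule.span_le]
  rintro _ ⟨β, rfl⟩
  exact ⟨_, by rw [soclePairing_dual, Pi.basisFun_apply]⟩

theorem eq_zero_of_soclePairing_stdSum {k : Type*} [Field k] {q : ℕ}
    {v : Fin 2 × Fin q × Fin q → k} (h : soclePairing k q (stdSum k q v) = 0) : v = 0 := by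
  ext β
  have key : socleForm k q (stdSum k q v * stdMon k q (dualIndex β)) = v β := by
    rw [stdSum, Fintype.linearCombination_apply, Finset.sum_mul, map_sum]
    have : ∀ γ, socleForm k q (v γ • stdMon k q γ * stdMon k q (dualIndex β)) =
        v γ * (Pi.single β 1 : _ → k) γ := fun γ => by
      rw [smul_mul_assoc, map_smul, mul_comm, ← soclePairing_apply, soclePairing_dual, smul_eq_mul]
    simp only [this, Pi.single_apply]
    simp
  rw [← key, ← soclePairing_apply, h]
  rfl

theorem soclePairing_eq_zero_iff {k : Type*} [Field k] {q : ℕ} {x : MvPolynomial (Fin 3) k} :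
    soclePairing k q x = 0 ↔ x ∈ parameterIdeal k q := by
  refine ⟨fun h => ?_, soclePairing_eq_zero⟩
  obtain ⟨v, hv⟩ := exists_sub_stdSum_mem (q := q) x
  have h' := soclePairing_eq_zero hv
  rw [map_sub, h, zero_sub, neg_eq_zero] at h'
  rw [eq_zero_of_soclePairing_stdSum h'] at hv
  simpa using hv

/-- The matrix of the form `(x, y) ↦ socleForm (U^q x y)` on standard monomials. -/
def socleMatrix (k : Type*) [Field k] (q : ℕ) :
    Matrix (Fin 2 × Fin q × Fin q) (Fin 2 × Fin q × Fin q) k :=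
  Matrix.of fun γ β => socleForm k q (X 0 ^ q * stdMon k q β * stdMon k q γ)

theorem socleMatrix_mulVec {k : Type*} [Field k] {q : ℕ} (v : Fin 2 × Fin q × Fin q → k) :
    (socleMatrix k q).mulVec v = soclePairing k q (X 0 ^ q * stdSum k q v) := by
  ext γ
  rw [soclePairing_apply, stdSum, Fintype.linearCombination_apply, Finset.mul_sum,
    Finset.sum_mul, map_sum]
  refine Finset.sum_congr rfl fun β _ => ?_
  rw [mul_smul_comm, smul_mul_assoc, map_smul, smul_eq_mul, mul_comm]
  rfl

theorem socleMatrix_apply {k : Type*} [Field k] {q : ℕ} (γ β : Fin 2 × Fin q × Fin q) :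
    socleMatrix k q γ β =
      socleCoeff k q (q + β.1 + γ.1) (β.2.1 + γ.2.1) (β.2.2 + γ.2.2) := by
  rw [← socleForm_mon, ← mon_mul_mon]
  have : mon k (q + β.1) β.2.1 β.2.2 = X 0 ^ q * stdMon k q β := by
    simp only [mon, stdMon]
    ring
  rw [this]
  rfl

/-- The quotient of the `E₆` ring by the `q`-th powers of the coordinates. -/
abbrev FrobeniusQuotient (k : Type*) [Field k] (q : ℕ) : Type _ :=
  (MvPolynomial (Fin 3) k ⧸ e6Rel k) ⧸
    Ideal.span {Ideal.Quotient.mk (e6Rel k) (X 0) ^ q, Ideal.Quotient.mk (e6Rel k) (X 1) ^ q,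
      Ideal.Quotient.mk (e6Rel k) (X 2) ^ q}

theorem exists_surjective_frobeniusQuotient (k : Type*) [Field k] (q : ℕ) :
    ∃ ρ : MvPolynomial (Fin 3) k →ₗ[k] FrobeniusQuotient k q, Function.Surjective ρ ∧
      ∀ x, ρ x = 0 ↔ ∃ a, x - X 0 ^ q * a ∈ parameterIdeal k q := by
  refine ⟨((Ideal.Quotient.mkₐ k _).comp (Ideal.Quotient.mkₐ k (e6Rel k))).toLinearMap,
    Ideal.Quotient.mk_surjective.comp Ideal.Quotient.mk_surjective, fun x => ?_⟩
  change Ideal.Quotient.mk _ (Ideal.Quotient.mk (e6Rel k) x) = 0 ↔ _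
  rw [Ideal.Quotient.eq_zero_iff_mem, Submodule.mem_span_triple]
  constructor
  · rintro ⟨a, b, c, h⟩
    obtain ⟨a, rfl⟩ := Ideal.Quotient.mk_surjective a
    obtain ⟨b, rfl⟩ := Ideal.Quotient.mk_surjective b
    obtain ⟨c, rfl⟩ := Ideal.Quotient.mk_surjective c
    simp only [smul_eq_mul, ← map_pow, ← map_mul, ← map_add] at h
    rw [eq_comm, Ideal.Quotient.eq, e6Rel, Ideal.mem_span_singleton'] at h
    obtain ⟨d, hd⟩ := h
    refine ⟨a, mem_parameterIdeal.2 ⟨d, b, c, ?_⟩⟩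
    rw [hd]
    ring
  · rintro ⟨a, h⟩
    obtain ⟨d, b, c, h⟩ := mem_parameterIdeal.1 h
    refine ⟨Ideal.Quotient.mk _ a, Ideal.Quotient.mk _ b, Ideal.Quotient.mk _ c, ?_⟩
    simp only [smul_eq_mul, ← map_pow, ← map_mul, ← map_add]
    rw [eq_comm, Ideal.Quotient.eq, e6Rel, Ideal.mem_span_singleton']
    refine ⟨d, ?_⟩
    linear_combination h

/-- The dimension of the Frobenius quotient is the nullity of `socleMatrix`. -/
theorem finrank_frobeniusQuotient (k : Type*) [Field k] (q : ℕ) :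
    Module.finrank k (FrobeniusQuotient k q) =
      Module.finrank k (LinearMap.ker (socleMatrix k q).mulVecLin) := by
  obtain ⟨ρ, hρ, hker⟩ := exists_surjective_frobeniusQuotient k q
  have h := finrank_add_finrank_map_ker ρ hρ (soclePairing k q) (soclePairing_surjective k q)
    (fun x hx => (hker x).2 ⟨0, by simpa using soclePairing_eq_zero_iff.1 hx⟩)
  have hmap : (LinearMap.ker ρ).map (soclePairing k q) =
      LinearMap.range (socleMatrix k q).mulVecLin := by
    ext y
    constructor
    · rintro ⟨x, hx, rfl⟩
      obtain ⟨a, ha⟩ := (hker x).1 hx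
      obtain ⟨v, hv⟩ := exists_sub_stdSum_mem (q := q) a
      refine ⟨v, ?_⟩
      rw [Matrix.mulVecLin_apply, socleMatrix_mulVec, eq_comm, ← sub_eq_zero, ← map_sub]
      refine soclePairing_eq_zero ?_
      have := Ideal.add_mem _ ha (Ideal.mul_mem_left _ (X 0 ^ q) hv)
      convert this using 1
      ring
    · rintro ⟨v, rfl⟩
      exact ⟨X 0 ^ q * stdSum k q v, (hker _).2 ⟨stdSum k q v, by simp⟩,
        by rw [Matrix.mulVecLin_apply, socleMatrix_mulVec]⟩
  rw [hmap, Module.finrank_fintype_fun_eq_card] at h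
  have h' := LinearMap.finrank_range_add_finrank_ker (socleMatrix k q).mulVecLin
  rw [Module.finrank_fintype_fun_eq_card] at h'
  omega

theorem finrank_frobeniusQuotient_of_pow_mem {k : Type*} [Field k] {q : ℕ}
    (h : X 0 ^ q ∈ parameterIdeal k q) :
    Module.finrank k (FrobeniusQuotient k q) = 2 * q ^ 2 := by
  have h0 : (socleMatrix k q).mulVecLin = 0 := by
    refine LinearMap.ext fun v => ?_
    rw [Matrix.mulVecLin_apply, socleMatrix_mulVec, LinearMap.zero_apply]
    exact soclePairing_eq_zero (Ideal.mul_mem_right _ _ h)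
  rw [finrank_frobeniusQuotient, h0, LinearMap.ker_zero, finrank_top,
    Module.finrank_fintype_fun_eq_card]
  simp [sq]

theorem sq_pow_mem_parameterIdeal {k : Type*} [Field k] {p : ℕ} [Fact p.Prime] [CharP k p]
    {e q : ℕ} (h₃ : q ≤ 3 * p ^ e) (h₄ : q ≤ 4 * p ^ e) :
    (X 0 ^ 2) ^ p ^ e ∈ parameterIdeal k q := by
  have hF : (X 0 ^ 2 + X 1 ^ 3 + X 2 ^ 4 : MvPolynomial (Fin 3) k) ∈ parameterIdeal k q :=
    Ideal.subset_span (by simp)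
  have hV : (X 1 ^ q : MvPolynomial (Fin 3) k) ∈ parameterIdeal k q := Ideal.subset_span (by simp)
  have hW : (X 2 ^ q : MvPolynomial (Fin 3) k) ∈ parameterIdeal k q := Ideal.subset_span (by simp)
  have h := Ideal.pow_mem_of_mem _ hF (p ^ e) (pow_pos (Fact.out : p.Prime).pos e)
  rw [add_pow_char_pow, add_pow_char_pow, ← pow_mul (X 1), ← pow_mul (X 2)] at h
  exact (Ideal.add_mem_iff_left _ (Ideal.pow_mem_of_pow_mem _ hV h₃)).1
    ((Ideal.add_mem_iff_left _ (Ideal.pow_mem_of_pow_mem _ hW h₄)).1 h)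

/-- The invariant of degree 12 of the binary tetrahedral group. -/
def tetU (k : Type*) [Field k] : MvPolynomial (Fin 2) k :=
  X 0 ^ 12 - 33 * X 0 ^ 8 * X 1 ^ 4 - 33 * X 0 ^ 4 * X 1 ^ 8 + X 1 ^ 12

/-- The invariant of degree 8 of the binary tetrahedral group. -/
def tetV (k : Type*) [Field k] : MvPolynomial (Fin 2) k :=
  X 0 ^ 8 + 14 * X 0 ^ 4 * X 1 ^ 4 + X 1 ^ 8

/-- The invariant of degree 6 of the binary tetrahedral group. -/
def tetW (k : Type*) [Field k] : MvPolynomial (Fin 2) k :=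
  X 0 * X 1 * (X 0 ^ 4 - X 1 ^ 4)

theorem tetU_sq (k : Type*) [Field k] : tetU k ^ 2 = tetV k ^ 3 - 108 * tetW k ^ 4 := by
  simp only [tetU, tetV, tetW]
  ring

theorem X_zero_mul_tetU (k : Type*) [Field k] :
    X 0 * tetU k = (X 0 ^ 5 - 5 * X 0 * X 1 ^ 4) * tetV k -
      (42 * X 0 ^ 4 * X 1 ^ 3 + 6 * X 1 ^ 7) * tetW k := by
  simp only [tetU, tetV, tetW]
  ring

theorem X_one_mul_tetU (k : Type*) [Field k] :
    X 1 * tetU k = (X 1 ^ 5 - 5 * X 0 ^ 4 * X 1) * tetV k +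
      (6 * X 0 ^ 7 + 42 * X 0 ^ 3 * X 1 ^ 4) * tetW k := by
  simp only [tetU, tetV, tetW]
  ring

theorem isRelPrime_tetW_tetV {k : Type*} [Field k] (h2 : (2 : k) ≠ 0) :
    IsRelPrime (tetW k) (tetV k) := by
  have hst : IsRelPrime (X 0 : MvPolynomial (Fin 2) k) (X 1) := by
    refine (Irreducible.isRelPrime_iff_not_dvd (X_prime.irreducible)).2 fun h => ?_
    rw [X_dvd_X] at h
    simp at h
  have h16 : IsUnit (16 : MvPolynomial (Fin 2) k) := by
    have : (16 : MvPolynomial (Fin 2) k) = C (2 ^ 4) := by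
      rw [map_pow, map_ofNat]
      norm_num
    rw [this]
    exact (isUnit_iff_ne_zero.2 (pow_ne_zero 4 h2)).map C
  have hs : IsRelPrime (X 0 : MvPolynomial (Fin 2) k) (tetV k) := fun d hd hV =>
    (hst.pow_right (n := 8)) hd (by
      have : (X 1 : MvPolynomial (Fin 2) k) ^ 8 =
          tetV k - X 0 * (X 0 ^ 7 + 14 * X 0 ^ 3 * X 1 ^ 4) := by
        simp only [tetV]
        ring
      rw [this]
      exact dvd_sub hV (hd.mul_right _))
  have ht : IsRelPrime (X 1 : MvPolynomial (Fin 2) k) (tetV k) := fun d hd hV =>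
    (hst.symm.pow_right (n := 8)) hd (by
      have : (X 0 : MvPolynomial (Fin 2) k) ^ 8 =
          tetV k - X 1 * (X 1 ^ 7 + 14 * X 0 ^ 4 * X 1 ^ 3) := by
        simp only [tetV]
        ring
      rw [this]
      exact dvd_sub hV (hd.mul_right _))
  refine IsRelPrime.mul_left (hs.mul_left ht) fun d hd hV => ?_
  have h16st : d ∣ 16 * (X 0 ^ 4 * X 1 ^ 4) := by
    have : (16 : MvPolynomial (Fin 2) k) * (X 0 ^ 4 * X 1 ^ 4) =
        tetV k - (X 0 ^ 4 - X 1 ^ 4) * (X 0 ^ 4 - X 1 ^ 4) := by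
      simp only [tetV]
      ring
    rw [this]
    exact dvd_sub hV (hd.mul_right _)
  have hst4 := h16.dvd_mul_left.1 h16st
  exact ((hs.pow_left (m := 4)).mul_left (ht.pow_left (m := 4))) hst4 hV

theorem tetW_ne_zero (k : Type*) [Field k] : tetW k ≠ 0 := by
  refine mul_ne_zero (mul_ne_zero (X_ne_zero _) (X_ne_zero _)) fun h => ?_
  simpa using congrArg (eval ![1, 0]) h

/-- In `k[s,t]`, the colon ideal `(V^q, W^q) : U^q` is contained in `(s^q, t^q)`. -/
theorem exists_eq_of_mul_tetU_pow {k : Type*} [Field k] {p : ℕ} [Fact p.Prime] [CharP k p]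
    (h2 : (2 : k) ≠ 0) (h3 : (3 : k) ≠ 0) (e : ℕ) {g A B : MvPolynomial (Fin 2) k}
    (h : g * tetU k ^ p ^ e = A * tetV k ^ p ^ e + B * tetW k ^ p ^ e) :
    ∃ l m, g = X 0 ^ p ^ e * m + X 1 ^ p ^ e * l := by
  have hrel : IsRelPrime (tetW k ^ p ^ e) (tetV k ^ p ^ e) :=
    (isRelPrime_tetW_tetV h2).pow
  have hW : tetW k ^ p ^ e ≠ 0 := pow_ne_zero _ (tetW_ne_zero k)
  have h₀ := congrArg (· ^ p ^ e) (X_zero_mul_tetU k)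
  have h₁ := congrArg (· ^ p ^ e) (X_one_mul_tetU k)
  have h₂ : (X 1 * (X 0 ^ 5 - 5 * X 0 * X 1 ^ 4) - X 0 * (X 1 ^ 5 - 5 * X 0 ^ 4 * X 1)) ^ p ^ e =
      (6 * tetW k) ^ p ^ e := by
    congr 1
    simp only [tetW]
    ring
  generalize (X 0 ^ 5 - 5 * X 0 * X 1 ^ 4 : MvPolynomial (Fin 2) k) = a at h₀ h₂
  generalize (X 1 ^ 5 - 5 * X 0 ^ 4 * X 1 : MvPolynomial (Fin 2) k) = a' at h₁ h₂
  generalize (42 * X 0 ^ 4 * X 1 ^ 3 + 6 * X 1 ^ 7 : MvPolynomial (Fin 2) k) = b at h₀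
  generalize (6 * X 0 ^ 7 + 42 * X 0 ^ 3 * X 1 ^ 4 : MvPolynomial (Fin 2) k) = b' at h₁
  simp only [sub_pow_char_pow, add_pow_char_pow] at h₀ h₁ h₂
  simp only [mul_pow] at h₀ h₁ h₂
  obtain ⟨l, hl⟩ : tetW k ^ p ^ e ∣ X 0 ^ p ^ e * A - g * a ^ p ^ e :=
    hrel.dvd_of_dvd_mul_right
      ⟨-(X 0 ^ p ^ e * B + g * b ^ p ^ e), by linear_combination g * h₀ - X 0 ^ p ^ e * h⟩
  obtain ⟨m, hm⟩ : tetW k ^ p ^ e ∣ X 1 ^ p ^ e * A - g * a' ^ p ^ e :=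
    hrel.dvd_of_dvd_mul_right
      ⟨-(X 1 ^ p ^ e * B - g * b' ^ p ^ e), by linear_combination g * h₁ - X 1 ^ p ^ e * h⟩
  have key : 6 ^ p ^ e * g = X 0 ^ p ^ e * m - X 1 ^ p ^ e * l := by
    refine mul_left_cancel₀ hW ?_
    linear_combination -g * h₂ - X 1 ^ p ^ e * hl + X 0 ^ p ^ e * hm
  have h6 : C ((6 : k)⁻¹ ^ p ^ e) * (6 : MvPolynomial (Fin 2) k) ^ p ^ e = 1 := by
    have h6' : (6 : k) ≠ 0 := by
      rw [show (6 : k) = 2 * 3 by norm_num]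
      exact mul_ne_zero h2 h3
    have : (6 : MvPolynomial (Fin 2) k) = C 6 := by rw [map_ofNat]
    rw [this, ← map_pow, ← map_mul, ← mul_pow, inv_mul_cancel₀ h6', one_pow, map_one]
  exact ⟨-(C ((6 : k)⁻¹ ^ p ^ e) * l), C ((6 : k)⁻¹ ^ p ^ e) * m, by
    linear_combination C ((6 : k)⁻¹ ^ p ^ e) * key - g * h6⟩

theorem eq_zero_of_totalDegree_lt {k : Type*} [Field k] {q : ℕ} {g l m : MvPolynomial (Fin 2) k}
    (hg : g = X 0 ^ q * m + X 1 ^ q * l) (h : g.totalDegree < q) : g = 0 := by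
  have hX : ∀ (i : Fin 2) (f : MvPolynomial (Fin 2) k) (d : Fin 2 →₀ ℕ), d i < q →
      coeff d (X i ^ q * f) = 0 := fun i f d hd => by
    rw [X_pow_eq_monomial, coeff_monomial_mul', if_neg]
    intro hle
    simpa using (hle i).trans_lt hd
  by_contra hne
  obtain ⟨d, hd⟩ := support_nonempty.2 hne
  have hdeg := (le_totalDegree hd).trans_lt h
  rw [Finsupp.sum_fintype _ _ (by simp), Fin.sum_univ_two] at hdeg
  refine mem_support_iff.1 hd ?_
  rw [hg, coeff_add, hX 0 _ _ (by omega), hX 1 _ _ (by omega), add_zero]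

theorem totalDegree_form_le {k : Type*} [Field k] (a b : ℕ) (c : k) :
    (C c * X 0 ^ a * X 1 ^ b : MvPolynomial (Fin 2) k).totalDegree ≤ a + b := by
  refine (totalDegree_mul _ _).trans (add_le_add ((totalDegree_mul _ _).trans ?_) ?_)
  · rw [totalDegree_C, totalDegree_X_pow, zero_add]
  · rw [totalDegree_X_pow]

theorem totalDegree_tetU_le (k : Type*) [Field k] : (tetU k).totalDegree ≤ 12 := by
  have h : tetU k = C 1 * X 0 ^ 12 * X 1 ^ 0 - C 33 * X 0 ^ 8 * X 1 ^ 4 -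
      C 33 * X 0 ^ 4 * X 1 ^ 8 + C 1 * X 0 ^ 0 * X 1 ^ 12 := by
    simp only [tetU, map_ofNat, map_one]
    ring
  rw [h]
  exact (totalDegree_add _ _).trans (max_le ((totalDegree_sub _ _).trans (max_le
    ((totalDegree_sub _ _).trans (max_le (totalDegree_form_le _ _ _) (totalDegree_form_le _ _ _)))
    (totalDegree_form_le _ _ _))) (totalDegree_form_le _ _ _))

theorem totalDegree_tetV_le (k : Type*) [Field k] : (tetV k).totalDegree ≤ 8 := by
  have h : tetV k = C 1 * X 0 ^ 8 * X 1 ^ 0 + C 14 * X 0 ^ 4 * X 1 ^ 4 +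
      C 1 * X 0 ^ 0 * X 1 ^ 8 := by
    simp only [tetV, map_ofNat, map_one]
    ring
  rw [h]
  exact (totalDegree_add _ _).trans (max_le ((totalDegree_add _ _).trans (max_le
    (totalDegree_form_le _ _ _) (totalDegree_form_le _ _ _))) (totalDegree_form_le _ _ _))

theorem totalDegree_tetW_le (k : Type*) [Field k] : (tetW k).totalDegree ≤ 6 := by
  have h : tetW k = C 1 * X 0 ^ 5 * X 1 ^ 1 - C 1 * X 0 ^ 1 * X 1 ^ 5 := by
    simp only [tetW, map_one]
    ring
  rw [h]
  exact (totalDegree_sub _ _).trans (max_le (totalDegree_form_le _ _ _)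
    (totalDegree_form_le _ _ _))

/-- The map `k[U,V,W] → k[s,t]` parametrizing the `E₆` surface, where `ω⁴ = 108`. -/
def tetMap {k : Type*} [Field k] (ω : k) : MvPolynomial (Fin 3) k →ₐ[k] MvPolynomial (Fin 2) k :=
  aeval ![tetU k, -tetV k, C ω * tetW k]

theorem tetMap_relation {k : Type*} [Field k] {ω : k} (hω : ω ^ 4 = 108) :
    tetMap ω (X 0 ^ 2 + X 1 ^ 3 + X 2 ^ 4) = 0 := by
  have hC : (C ω : MvPolynomial (Fin 2) k) ^ 4 = 108 := by rw [← map_pow, hω, map_ofNat]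
  simp only [tetMap, map_add, map_pow, aeval_X, Matrix.cons_val]
  linear_combination tetU_sq k + tetW k ^ 4 * hC

theorem totalDegree_tetMap_mon_le {k : Type*} [Field k] (ω : k) (a b c : ℕ) :
    (tetMap ω (mon k a b c)).totalDegree ≤ 12 * a + 8 * b + 6 * c := by
  have hV : (-tetV k).totalDegree ≤ 8 := by
    rw [totalDegree_neg]
    exact totalDegree_tetV_le k
  have hW : (C ω * tetW k).totalDegree ≤ 6 := by
    refine (totalDegree_mul _ _).trans ?_
    rw [totalDegree_C, zero_add]
    exact totalDegree_tetW_le k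
  simp only [tetMap, mon, map_mul, map_pow, aeval_X, Matrix.cons_val]
  refine (totalDegree_mul _ _).trans (add_le_add ((totalDegree_mul _ _).trans (add_le_add ?_ ?_))
    ?_)
  all_goals refine (totalDegree_pow _ _).trans ?_
  all_goals rw [mul_comm]
  · exact Nat.mul_le_mul_right _ (totalDegree_tetU_le k)
  · exact Nat.mul_le_mul_right _ hV
  · exact Nat.mul_le_mul_right _ hW

/-- Polynomial combinations of `U^ε V^i W^j` with `ε < 2` vanish only trivially, provided `U`, `V`
and `W` specialize to `T^12`, `-T^8` and `0`. -/
theorem coeff_eq_zero_of_sum_eq_zero {k S : Type*} [Field k] [CommRing S] [IsDomain S]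
    [Algebra k S] (θ : S →ₐ[k] Polynomial k) {U V W : S} (hU : θ U = Polynomial.X ^ 12)
    (hV : θ V = -Polynomial.X ^ 8) (hW : θ W = 0) (hW0 : W ≠ 0) {q : ℕ} (n : ℕ) :
    ∀ c : ℕ → Fin 2 × Fin q → k,
      ∑ j ∈ Finset.range n, (∑ a, c j a • (U ^ (a.1 : ℕ) * V ^ (a.2 : ℕ))) * W ^ j = 0 →
      ∀ j < n, c j = 0 := by
  induction n with
  | zero => simp
  | succ n ih =>
    intro c h
    have h0 : c 0 = 0 := by
      have hθ := congrArg θ h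
      rw [Finset.sum_range_succ'] at hθ
      simp only [map_add, map_sum, map_mul, map_pow, map_smul, hU, hV, hW,
        zero_pow (Nat.succ_ne_zero _), pow_zero, mul_zero, Finset.sum_const_zero, zero_add, mul_one, map_zero] at hθ
      have hmon : ∀ a b : ℕ, (Polynomial.X ^ 12 : Polynomial k) ^ a * (-Polynomial.X ^ 8) ^ b =
          Polynomial.C ((-1) ^ b) * Polynomial.X ^ (12 * a + 8 * b) := fun a b => by
        rw [neg_pow, map_pow, map_neg, map_one]
        ring
      ext ⟨ε, i⟩
      have hc := congrArg (Polynomial.coeff · (12 * ε + 8 * i)) hθ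
      simp only [hmon, Polynomial.finsetSum_coeff, Polynomial.coeff_smul, Polynomial.coeff_zero,
        Polynomial.coeff_C_mul_X_pow] at hc
      rw [Finset.sum_eq_single (ε, i)] at hc
      · simpa using hc
      · rintro ⟨ε', i'⟩ - hne
        rw [if_neg, smul_zero]
        intro heq
        dsimp only at heq
        refine hne (Prod.ext (Fin.ext ?_) (Fin.ext ?_)) <;> simp only <;> omega
      · simp
    have hsucc : ∀ j < n, c (j + 1) = 0 := by
      refine ih (fun j => c (j + 1)) (mul_right_cancel₀ hW0 ?_)
      rw [Finset.sum_range_succ', h0] at h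
      rw [zero_mul, ← h, Finset.sum_mul]
      simp [pow_succ, mul_assoc]
    rintro (_ | j) hj
    · exact h0
    · exact hsucc j (by omega)

theorem eq_zero_of_tetMap_stdSum {k : Type*} [Field k] {ω : k} (hω : ω ≠ 0) {q : ℕ}
    {v : Fin 2 × Fin q × Fin q → k} (h : tetMap ω (stdSum k q v) = 0) : v = 0 := by
  have hW0 : C ω * tetW k ≠ 0 := mul_ne_zero (by simpa using hω) (tetW_ne_zero k)
  have key := coeff_eq_zero_of_sum_eq_zero (aeval ![0, Polynomial.X] : _ →ₐ[k] Polynomial k)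
    (U := tetU k) (V := -tetV k) (W := C ω * tetW k) (by simp [tetU]) (by simp [tetV])
    (by simp [tetW]) hW0 (q := q) q
    (fun j a => if hj : j < q then v (a.1, a.2, ⟨j, hj⟩) else 0) (by
      rw [← h, stdSum, Fintype.linearCombination_apply, map_sum, Finset.sum_range,
        Fintype.sum_prod_type, Fintype.sum_congr _ _ fun _ => Fintype.sum_prod_type _]
      simp only [Fintype.sum_prod_type, Finset.sum_mul, Fin.is_lt, dite_true]
      rw [Finset.sum_comm]
      refine Finset.sum_congr rfl fun ε _ => ?_
      rw [Finset.sum_comm]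
      refine Finset.sum_congr rfl fun i _ => Finset.sum_congr rfl fun j _ => ?_
      simp [stdMon, mon, tetMap])
  ext ⟨ε, i, j⟩
  simpa using congrFun (key j j.2) (ε, i)

/-- The weighted degree of a standard monomial. -/
def stdWeight {q : ℕ} (β : Fin 2 × Fin q × Fin q) : ℕ := 6 * β.1 + 4 * β.2.1 + 3 * β.2.2

theorem eq_zero_of_socleMatrix_mulVec {k : Type*} [Field k] {p : ℕ} [Fact p.Prime] [CharP k p]
    (h2 : (2 : k) ≠ 0) (h3 : (3 : k) ≠ 0) {ω : k} (hω : ω ^ 4 = 108) (e : ℕ)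
    {v : Fin 2 × Fin (p ^ e) × Fin (p ^ e) → k} (hv : ∀ β, p ^ e ≤ 2 * stdWeight β → v β = 0)
    (h : (socleMatrix k (p ^ e)).mulVec v = 0) : v = 0 := by
  have hω0 : ω ≠ 0 := by
    rintro rfl
    have : (2 : k) ^ 2 * 3 ^ 3 = 0 := by linear_combination -hω
    exact mul_ne_zero (pow_ne_zero 2 h2) (pow_ne_zero 3 h3) this
  rw [socleMatrix_mulVec, soclePairing_eq_zero_iff, mem_parameterIdeal] at h
  obtain ⟨a, b, c, h⟩ := h
  have hS := congrArg (tetMap ω) h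
  rw [map_add, map_add, map_mul, tetMap_relation hω, mul_zero, zero_add] at hS
  simp only [map_mul, map_pow] at hS
  have h₀ : tetMap ω (X 0) = tetU k := by simp [tetMap]
  have h₁ : tetMap ω (X 1) = -tetV k := by simp [tetMap]
  have h₂ : tetMap ω (X 2) = C ω * tetW k := by simp [tetMap]
  rw [h₀, h₁, h₂, neg_pow, mul_pow] at hS
  obtain ⟨l, m, hlm⟩ := exists_eq_of_mul_tetU_pow (p := p) h2 h3 e
    (g := tetMap ω (stdSum k (p ^ e) v)) (A := tetMap ω b * (-1) ^ p ^ e)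
    (B := tetMap ω c * C ω ^ p ^ e) (by linear_combination -hS)
  refine eq_zero_of_tetMap_stdSum hω0 (eq_zero_of_totalDegree_lt hlm ?_)
  have hq : 0 < p ^ e := pow_pos (Fact.out : p.Prime).pos e
  rw [stdSum, Fintype.linearCombination_apply, map_sum]
  refine (totalDegree_finsetSum_le (d := p ^ e - 1) fun β _ => ?_).trans_lt (by omega)
  by_cases hβ : p ^ e ≤ 2 * stdWeight β
  · simp [hv β hβ]
  · rw [map_smul]
    refine (totalDegree_smul_le _ _).trans ((totalDegree_tetMap_mon_le ω _ _ _).trans ?_)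
    simp only [stdWeight] at hβ
    omega

/-- The `W`-exponents of the standard monomials of weighted degree `d`. -/
def weightExponents (d : ℕ) : Finset ℕ :=
  {j ∈ Finset.range (d + 1) | 3 * j ≤ d ∧ (d - 3 * j) % 2 = 0 ∧ d ≠ 3 * j + 2}

theorem card_stdWeight_eq {q d : ℕ} (hd : d < q) :
    (Finset.univ.filter fun β : Fin 2 × Fin q × Fin q => stdWeight β = d).card =
      (weightExponents d).card := by
  refine Finset.card_bij (fun β _ => (β.2.2 : ℕ)) ?_ ?_ ?_
  · rintro ⟨ε, i, j⟩ h
    simp only [Finset.mem_filter, Finset.mem_univ, true_and, weightExponents,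
      Finset.mem_range] at h ⊢
    simp only [stdWeight] at h
    omega
  · rintro ⟨ε, i, j⟩ h ⟨ε', i', j'⟩ h' hj
    simp only [Finset.mem_filter, Finset.mem_univ, true_and] at h h' hj
    simp only [stdWeight] at h h'
    simp only [Prod.mk.injEq, Fin.ext_iff]
    omega
  · intro j hj
    simp only [weightExponents, Finset.mem_filter, Finset.mem_range] at hj
    refine ⟨(⟨(d - 3 * j) / 2 % 2, by omega⟩,
      ⟨((d - 3 * j) / 2 - 3 * ((d - 3 * j) / 2 % 2)) / 2, by omega⟩, ⟨j, by omega⟩), ?_, rfl⟩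
    simp only [Finset.mem_filter, Finset.mem_univ, true_and]
    simp only [stdWeight]
    omega

theorem card_weightExponents_add_three (d : ℕ) :
    (weightExponents (d + 3)).card = (weightExponents d).card + if d % 2 = 1 then 1 else 0 := by
  have hmem : ∀ j, j ∈ weightExponents (d + 3) ↔
      (j = 0 ∧ d % 2 = 1) ∨ ∃ i ∈ weightExponents d, i + 1 = j := by
    intro j
    simp only [weightExponents, Finset.mem_filter, Finset.mem_range]
    constructor
    · intro h
      rcases j with _ | j
      · left
        omega
      · exact Or.inr ⟨j, by omega, rfl⟩
    · rintro (h | ⟨i, hi, rfl⟩) <;> omega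
  have himage : ((weightExponents d).image (· + 1)).card = (weightExponents d).card :=
    Finset.card_image_of_injective _ (add_left_injective 1)
  split_ifs with hd
  · rw [← himage, ← Finset.card_insert_of_notMem (a := 0) (by simp)]
    congr 1
    ext j
    simp [hmem, hd]
  · rw [add_zero, ← himage]
    congr 1
    ext j
    simp [hmem, hd]

theorem card_weightExponents_add_card_succ : ∀ r : ℕ,
    3 * ((weightExponents r).card + (weightExponents (r + 1)).card) +
      (if r % 3 = 1 then 2 else 0) = r + 1 + if r % 3 = 0 then 2 else 0
  | 0 => by decide
  | 1 => by decide
  | 2 => by decide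
  | r + 3 => by
    have ih := card_weightExponents_add_card_succ r
    have h := card_weightExponents_add_three r
    have h' := card_weightExponents_add_three (r + 1)
    rw [show r + 3 + 1 = r + 1 + 3 by ring, h, h']
    split_ifs at ih ⊢ <;> omega

theorem two_mul_sum_card_weightExponents (r : ℕ) :
    6 * (2 * ∑ d ∈ Finset.range r, (weightExponents d).card + (weightExponents r).card) =
      r ^ 2 + r + 6 + if r % 3 = 1 then 4 else 0 := by
  induction r with
  | zero => decide
  | succ r ih =>
    have h := card_weightExponents_add_card_succ r
    rw [Finset.sum_range_succ, add_sq]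
    split_ifs at ih h ⊢ <;> omega

theorem finrank_frobeniusQuotient_of_five_le {k : Type*} [Field k] [IsAlgClosed k] {p : ℕ}
    [Fact p.Prime] [CharP k p] (hp : 5 ≤ p) (e : ℕ) :
    24 * Module.finrank k (FrobeniusQuotient k (p ^ e)) + 23 = 47 * (p ^ e) ^ 2 := by
  have hprime : p.Prime := Fact.out
  have h2 : (2 : k) ≠ 0 := by
    intro h
    have := Nat.le_of_dvd (by norm_num) ((CharP.cast_eq_zero_iff k p 2).1 (by exact_mod_cast h))
    omega
  have h3 : (3 : k) ≠ 0 := by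
    intro h
    have := Nat.le_of_dvd (by norm_num) ((CharP.cast_eq_zero_iff k p 3).1 (by exact_mod_cast h))
    omega
  obtain ⟨ω, hω⟩ := IsAlgClosed.exists_pow_nat_eq (108 : k) (n := 4) (by norm_num)
  have hq2 : ¬ 2 ∣ p ^ e := fun h =>
    absurd ((Nat.prime_dvd_prime_iff_eq Nat.prime_two hprime).1
      (Nat.prime_two.dvd_of_dvd_pow h)) (by omega)
  have hq3 : ¬ 3 ∣ p ^ e := fun h =>
    absurd ((Nat.prime_dvd_prime_iff_eq Nat.prime_three hprime).1
      (Nat.prime_three.dvd_of_dvd_pow h)) (by omega)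
  have hinj := fun v => eq_zero_of_socleMatrix_mulVec (p := p) h2 h3 hω e (v := v)
  rw [finrank_frobeniusQuotient]
  generalize p ^ e = q at *
  obtain ⟨r, rfl⟩ : ∃ r, q = 2 * r + 1 := ⟨q / 2, by omega⟩
  have hker := finrank_ker_of_opposite_weights (socleMatrix k (2 * r + 1))
    (fun β => (stdWeight β : ℤ) - r)
    (fun γ β => by
      simp only [socleMatrix_apply]
      congr 1 <;> ring)
    (fun γ β h => by
      by_contra hne
      refine h ?_
      rw [socleMatrix_apply]
      refine socleCoeff_eq_zero_of_weight ?_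
      simp only [stdWeight] at hne
      omega)
    (fun v hv => hinj v fun β hβ => hv β (by omega))
  have hlow : Fintype.card {β : Fin 2 × Fin (2 * r + 1) × Fin (2 * r + 1) //
      (stdWeight β : ℤ) - r < 0} = ∑ d ∈ Finset.range r, (weightExponents d).card := by
    rw [Fintype.card_subtype, Finset.card_eq_sum_card_fiberwise (f := stdWeight)
      (t := Finset.range r)]
    · refine Finset.sum_congr rfl fun d hd => ?_
      rw [Finset.mem_range] at hd
      rw [← card_stdWeight_eq (q := 2 * r + 1) (by omega), Finset.filter_filter]
      congr 1
      ext β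
      simp only [Finset.mem_filter, Finset.mem_univ, true_and]
      omega
    · intro β hβ
      simp only [Finset.coe_filter, Finset.mem_univ, true_and, Set.mem_ofPred_eq,
        Finset.coe_range, Set.mem_Iio] at hβ ⊢
      omega
  have hmid := card_stdWeight_eq (q := 2 * r + 1) (d := r) (by omega)
  have htotal : Fintype.card {β : Fin 2 × Fin (2 * r + 1) × Fin (2 * r + 1) //
      (stdWeight β : ℤ) - r < 0} +
      (Finset.univ.filter fun β : Fin 2 × Fin (2 * r + 1) × Fin (2 * r + 1) =>
        stdWeight β = r).card +
      Fintype.card {β : Fin 2 × Fin (2 * r + 1) × Fin (2 * r + 1) //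
      0 < (stdWeight β : ℤ) - r} = 2 * (2 * r + 1) ^ 2 := by
    have hcard : Fintype.card (Fin 2 × Fin (2 * r + 1) × Fin (2 * r + 1)) =
        2 * (2 * r + 1) ^ 2 := by
      simp [sq]
    rw [← hcard, Fintype.card_subtype, Fintype.card_subtype, ← Finset.card_univ,
      ← Finset.card_union_of_disjoint, ← Finset.card_union_of_disjoint]
    · congr 1
      ext β
      simp only [Finset.mem_union, Finset.mem_filter, Finset.mem_univ, true_and, iff_true]
      omega
    · rw [Finset.disjoint_left]
      intro β hβ
      simp only [Finset.mem_union, Finset.mem_filter, Finset.mem_univ, true_and] at hβ ⊢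
      omega
    · rw [Finset.disjoint_left]
      intro β hβ
      simp only [Finset.mem_filter, Finset.mem_univ, true_and] at hβ ⊢
      omega
  have hcount := two_mul_sum_card_weightExponents r
  rw [if_neg (by omega)] at hcount
  rw [← hlow, ← hmid] at hcount
  nlinarith

/-- For `R = k[U,V,W]/(U²+V³+W⁴)` (type `E₆`) over an algebraically closed field of
characteristic `p ≥ 5`: `HKF(R,p^e) = (2 - 1/24)·p^{2e} - 23/24` for all `e ≥ 0`;
if instead `p ∈ {2,3}`, then `HKF(R,p^e) = 2·p^{2e}` for all `e ≥ 1`. -/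
theorem stmt15 (k : Type*) [Field k] [IsAlgClosed k] (p : ℕ) (hp : p.Prime) [CharP k p] :
    (5 ≤ p → ∀ e : ℕ,
      (Module.finrank k
          ((MvPolynomial (Fin 3) k ⧸ e6Rel k) ⧸
            Ideal.span {Ideal.Quotient.mk (e6Rel k) (X 0) ^ p ^ e,
              Ideal.Quotient.mk (e6Rel k) (X 1) ^ p ^ e,
              Ideal.Quotient.mk (e6Rel k) (X 2) ^ p ^ e}) : ℚ) =
        (2 - 1 / 24) * (p : ℚ) ^ (2 * e) - 23 / 24) ∧
    ((p = 2 ∨ p = 3) → ∀ e : ℕ, 1 ≤ e →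
      (Module.finrank k
          ((MvPolynomial (Fin 3) k ⧸ e6Rel k) ⧸
            Ideal.span {Ideal.Quotient.mk (e6Rel k) (X 0) ^ p ^ e,
              Ideal.Quotient.mk (e6Rel k) (X 1) ^ p ^ e,
              Ideal.Quotient.mk (e6Rel k) (X 2) ^ p ^ e}) : ℚ) =
        2 * (p : ℚ) ^ (2 * e)) := by
  have : Fact p.Prime := ⟨hp⟩
  refine ⟨fun h5 e => ?_, fun h23 e he => ?_⟩
  · have h := congrArg (Nat.cast : ℕ → ℚ) (finrank_frobeniusQuotient_of_five_le (k := k) h5 e)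
    push_cast at h
    rw [mul_comm 2 e, pow_mul]
    linear_combination h / 24
  · obtain ⟨e, rfl⟩ := Nat.exists_eq_add_of_le' he
    have hmem : X 0 ^ p ^ (e + 1) ∈ parameterIdeal k (p ^ (e + 1)) := by
      refine Ideal.pow_mem_of_pow_mem (m := 2 * p ^ e) _ ?_ ?_
      · rw [pow_mul]
        refine sq_pow_mem_parameterIdeal ?_ ?_ <;> rw [pow_succ'] <;>
          exact Nat.mul_le_mul_right _ (by omega)
      · rw [pow_succ']
        exact Nat.mul_le_mul_right _ hp.two_le
    have h := congrArg (Nat.cast : ℕ → ℚ) (finrank_frobeniusQuotient_of_pow_mem hmem)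
    push_cast at h
    rw [mul_comm 2 (e + 1), pow_mul]
    exact h
end
end

section
/- Let k be an algebraically closed field of characteristic p ∤ 4n, n ≥ 2, and R = k[U,V,W]/(U²+V^{n+1}+VW²) (type D_{n+2}). Write q = p^e and r ≡ q mod 2n with 0 ≤ r ≤ 2n-1. Then HKF(R,q) = (2 - 1/(4n))·q² - (r+1)/2 + r²/(4n). If p = 2 and e ≥ 1, then HKF(R,2^e) = 2·4^e. -/
open MvPolynomial

noncomputable section

/-- The defining ideal of the `D_{n+2}` surface ring `k[U,V,W]/(U²+V^{n+1}+VW²)`. -/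
def dnRel (k : Type*) [Field k] (n : ℕ) : Ideal (MvPolynomial (Fin 3) k) :=
  Ideal.span {X 0 ^ 2 + X 1 ^ (n + 1) + X 1 * X 2 ^ 2}

/-- The coefficients `(a, b)` of `(β - w) ^ i = a + β * b`, where `β ^ 2 = y`. -/
def binomPair {A : Type*} [CommRing A] (w y : A) : ℕ → A × A
  | 0 => (1, 0)
  | i + 1 => (-w * (binomPair w y i).1 + y * (binomPair w y i).2,
      (binomPair w y i).1 - w * (binomPair w y i).2)

/-- With `v = ν ^ 2`, `x = ν * β` and `β ^ 2 = v ^ n + w ^ 2`, this is the part of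
`ν ^ l * (β - w) ^ i` invariant under `(ν, β) ↦ (-ν, -β)`, as a polynomial in `x`, `v`, `w`. -/
def invariantPart {A : Type*} [CommRing A] (n : ℕ) (x v w : A) (i l : ℕ) : A :=
  v ^ (l / 2) * if Even l then (binomPair w (v ^ n + w ^ 2) i).1
    else (binomPair w (v ^ n + w ^ 2) i).2 * x

section CommRing

variable {A B : Type*} [CommRing A] [CommRing B]

lemma map_binomPair (f : A →+* B) (w y : A) (i : ℕ) :
    binomPair (f w) (f y) i = (f (binomPair w y i).1, f (binomPair w y i).2) := by
  induction i with
  | zero => simp [binomPair]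
  | succ i ih => simp [binomPair, ih]

lemma map_invariantPart (f : A →+* B) (n : ℕ) (x v w : A) (i l : ℕ) :
    f (invariantPart n x v w i l) = invariantPart n (f x) (f v) (f w) i l := by
  unfold invariantPart
  rw [show f v ^ n + f w ^ 2 = f (v ^ n + w ^ 2) by simp, map_binomPair]
  split_ifs <;> simp

lemma sub_pow_eq_binomPair {w y β : A} (hβ : β ^ 2 = y) (i : ℕ) :
    (β - w) ^ i = (binomPair w y i).1 + β * (binomPair w y i).2 := by
  induction i with
  | zero => simp [binomPair]
  | succ i ih => rw [pow_succ, ih]; simp only [binomPair]; rw [← hβ]; ring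

lemma add_pow_eq_binomPair {w y β : A} (hβ : β ^ 2 = y) (i : ℕ) :
    (β + w) ^ i = (-1) ^ i * ((binomPair w y i).1 - β * (binomPair w y i).2) := by
  have h := sub_pow_eq_binomPair (w := w) (β := -β) (by rw [neg_sq, hβ]) i
  rw [show β + w = (-1) * (-β - w) by ring, mul_pow, h]; ring

variable (n : ℕ) (x v w : A) (i l : ℕ)

lemma v_mul_invariantPart :
    v * invariantPart n x v w i l = invariantPart n x v w i (l + 2) := by
  have : (l + 2) / 2 = l / 2 + 1 := by omega
  simp only [invariantPart, this, Nat.even_add, even_two, iff_true]; ring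

lemma v_pow_mul_invariantPart (j : ℕ) :
    v ^ j * invariantPart n x v w i l = invariantPart n x v w i (l + 2 * j) := by
  induction j with
  | zero => simp
  | succ j ih => rw [pow_succ', mul_assoc, ih, v_mul_invariantPart]; rfl

lemma w_mul_invariantPart_succ :
    2 * (w * invariantPart n x v w (i + 1) l) =
      invariantPart n x v w i (l + 2 * n) - invariantPart n x v w (i + 2) l := by
  rw [← v_pow_mul_invariantPart]
  simp only [invariantPart, binomPair]
  split_ifs <;> ring

lemma w_mul_invariantPart_zero :
    w * invariantPart n x v w 0 l = - if Even l then invariantPart n x v w 1 l else 0 := by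
  simp only [invariantPart, binomPair]
  split_ifs <;> ring

variable {n x v w}

lemma x_mul_invariantPart_succ (hx : x ^ 2 = v * (v ^ n + w ^ 2)) :
    2 * (x * invariantPart n x v w (i + 1) l) =
      invariantPart n x v w (i + 2) (l + 1) + invariantPart n x v w i (l + 1 + 2 * n) := by
  rw [← v_pow_mul_invariantPart]
  simp only [invariantPart, binomPair, Nat.even_add_one]
  split_ifs with h
  · have : (l + 1) / 2 = l / 2 := by obtain ⟨m, rfl⟩ := h; omega
    rw [this]; ring
  · have : (l + 1) / 2 = l / 2 + 1 := by rw [Nat.not_even_iff_odd] at h; obtain ⟨m, rfl⟩ := h; omega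
    rw [this]
    linear_combination (2 * v ^ (l / 2) *
      ((binomPair w (v ^ n + w ^ 2) i).1 - w * (binomPair w (v ^ n + w ^ 2) i).2)) * hx

lemma x_mul_invariantPart_zero :
    x * invariantPart n x v w 0 l = if Even l then invariantPart n x v w 1 (l + 1) else 0 := by
  simp only [invariantPart, binomPair, Nat.even_add_one]
  split_ifs with h
  · have : (l + 1) / 2 = l / 2 := by obtain ⟨m, rfl⟩ := h; omega
    rw [this]; ring
  · ring

lemma invariantPart_eq (n : ℕ) {ν s t h : A} (hh : 2 * h = 1) (hst : s * t = ν ^ (2 * n))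
    (i l : ℕ) :
    invariantPart n (ν * (h * (s + t))) (ν ^ 2) (h * (t - s)) i l =
      h * (ν ^ l * (s ^ i + (-1) ^ (i + l) * t ^ i)) := by
  have hβ : (h * (s + t)) ^ 2 = (ν ^ 2) ^ n + (h * (t - s)) ^ 2 := by
    rw [← pow_mul, ← hst]
    linear_combination s * t * (1 + 2 * h) * hh
  have hs := sub_pow_eq_binomPair (w := h * (t - s)) hβ i
  have ht := add_pow_eq_binomPair (w := h * (t - s)) hβ i
  rw [show h * (s + t) - h * (t - s) = s by linear_combination s * hh] at hs
  rw [show h * (s + t) + h * (t - s) = t by linear_combination t * hh] at ht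
  rw [hs, ht]
  have h1 : ((-1 : A) ^ i) * (-1) ^ i = 1 := by rw [← mul_pow]; simp
  simp only [invariantPart]
  generalize (binomPair (h * (t - s)) ((ν ^ 2) ^ n + (h * (t - s)) ^ 2) i) = P
  split_ifs with hl
  · obtain ⟨m, rfl⟩ := hl
    have : (m + m) / 2 = m := by omega
    rw [this, pow_add (-1) i, Even.neg_one_pow ⟨m, rfl⟩]
    linear_combination (-(h * ν ^ (m + m) * (P.1 - h * (s + t) * P.2))) * h1 -
      ν ^ (2 * m) * P.1 * hh
  · rw [Nat.not_even_iff_odd] at hl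
    have h2 := hl.neg_one_pow (α := A)
    obtain ⟨m, rfl⟩ := hl
    have : (2 * m + 1) / 2 = m := by omega
    rw [this, pow_add (-1) i, h2]
    linear_combination ((h * ν ^ (2 * m + 1) * (P.1 - h * (s + t) * P.2))) * h1 -
      ν ^ (2 * m + 1) * (h * (s + t)) * P.2 * hh

end CommRing

section Reduction

open QuadraticAlgebra

variable {A : Type*} [CommRing A] {n p e m : ℕ} {x v w : A}

lemma omega_sq (y : A) : (ω : QuadraticAlgebra A y 0) ^ 2 = algebraMap A _ y := by
  ext <;> simp [pow_two]

lemma omega_sub_pow (y w : A) (i : ℕ) :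
    ((ω : QuadraticAlgebra A y 0) - algebraMap A _ w) ^ i =
      ⟨(binomPair w y i).1, (binomPair w y i).2⟩ := by
  rw [sub_pow_eq_binomPair (omega_sq y), map_binomPair]
  ext <;> simp

lemma omega_add_pow (y w : A) (i : ℕ) :
    ((ω : QuadraticAlgebra A y 0) + algebraMap A _ w) ^ i =
      algebraMap A _ ((-1) ^ i) * ⟨(binomPair w y i).1, -(binomPair w y i).2⟩ := by
  rw [add_pow_eq_binomPair (omega_sq y), map_binomPair, map_pow, map_neg, map_one]
  congr 1
  ext <;> simp

lemma omega_sub_pow_eq (hp : p.Prime) (hp0 : (p : A) = 0) (hw : w ^ p ^ e = 0) (y : A) :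
    ((ω : QuadraticAlgebra A y 0) - algebraMap A _ w) ^ p ^ e = ω ^ p ^ e := by
  nontriviality A
  have : CharP (QuadraticAlgebra A y 0) p := by
    rw [CharP.charP_iff_prime_eq_zero hp, ← map_natCast (algebraMap A _), hp0, map_zero]
  have : Fact p.Prime := ⟨hp⟩
  rw [sub_pow_char_pow, ← map_pow, hw, map_zero, sub_zero]

lemma omega_add_pow_eq (hp : p.Prime) (hp0 : (p : A) = 0) (hw : w ^ p ^ e = 0) (y : A) :
    ((ω : QuadraticAlgebra A y 0) + algebraMap A _ w) ^ p ^ e = ω ^ p ^ e := by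
  nontriviality A
  have : CharP (QuadraticAlgebra A y 0) p := by
    rw [CharP.charP_iff_prime_eq_zero hp, ← map_natCast (algebraMap A _), hp0, map_zero]
  have : Fact p.Prime := ⟨hp⟩
  rw [add_pow_char_pow, ← map_pow, hw, map_zero, add_zero]

lemma omega_sub_mul_omega_add (y w u : A) (h : y = u + w ^ 2) :
    ((ω : QuadraticAlgebra A y 0) - algebraMap A _ w) * (ω + algebraMap A _ w) =
      algebraMap A _ u := by
  have := omega_sq y
  have h2 : algebraMap A (QuadraticAlgebra A y 0) y = algebraMap A _ u + algebraMap A _ w ^ 2 := by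
    rw [← map_pow, ← map_add, ← h]
  linear_combination this + h2

lemma invariantPart_reflect (hp : p.Prime) (hp0 : (p : A) = 0) (hw : w ^ p ^ e = 0)
    {j : ℕ} (hj : j ≤ p ^ e) (l : ℕ) :
    invariantPart n x v w (p ^ e + j) l =
      (-1) ^ (p ^ e - j + l) * invariantPart n x v w (p ^ e - j) (l + 2 * (n * j)) := by
  have key : ((ω : QuadraticAlgebra A (v ^ n + w ^ 2) 0) - algebraMap A _ w) ^ (p ^ e + j) =
      algebraMap A _ (v ^ (n * j)) * (ω + algebraMap A _ w) ^ (p ^ e - j) := by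
    rw [pow_add, omega_sub_pow_eq hp hp0 hw, ← omega_add_pow_eq hp hp0 hw, pow_mul, map_pow,
      ← omega_sub_mul_omega_add _ w _ rfl, mul_pow]
    conv_lhs => rw [← Nat.sub_add_cancel hj, pow_add]
    ring
  rw [omega_sub_pow, omega_add_pow] at key
  have h1 := congrArg QuadraticAlgebra.re key
  have h2 := congrArg QuadraticAlgebra.im key
  simp only [← Algebra.smul_def, re_smul, im_smul, smul_eq_mul] at h1 h2
  rw [← v_pow_mul_invariantPart]
  simp only [invariantPart]
  split_ifs with hl
  · rw [h1, pow_add, hl.neg_one_pow]; ring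
  · rw [h2, pow_add, (Nat.not_even_iff_odd.1 hl).neg_one_pow]; ring

lemma invariantPart_eq_zero_of_le (hp : p.Prime) (hp0 : (p : A) = 0) (hw : w ^ p ^ e = 0)
    (hn : 1 ≤ n) (hv : v ^ p ^ e = 0) {i : ℕ} (hi : 2 * p ^ e ≤ i) (l : ℕ) :
    invariantPart n x v w i l = 0 := by
  obtain ⟨j, rfl⟩ := Nat.exists_eq_add_of_le hi
  have key : ((ω : QuadraticAlgebra A (v ^ n + w ^ 2) 0) - algebraMap A _ w) ^ (2 * p ^ e + j) =
      0 := by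
    rw [pow_add, two_mul, pow_add]
    nth_rw 2 [omega_sub_pow_eq hp hp0 hw]
    rw [← omega_add_pow_eq hp hp0 hw, ← mul_pow, omega_sub_mul_omega_add _ w _ rfl, ← map_pow,
      pow_right_comm, hv, zero_pow (by omega)]
    simp
  rw [omega_sub_pow] at key
  have h1 := congrArg QuadraticAlgebra.re key
  have h2 := congrArg QuadraticAlgebra.im key
  simp only [re_zero, im_zero] at h1 h2
  simp [invariantPart, h1, h2]

lemma invariantPart_eq_zero_of_two_mul_le {q : ℕ} (hv : v ^ q = 0) (i : ℕ) {l : ℕ}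
    (hl : 2 * q ≤ l) : invariantPart n x v w i l = 0 := by
  rw [invariantPart, pow_eq_zero_of_le (by omega) hv, zero_mul]

lemma invariantPart_eq_zero_of_add_le (hp : p.Prime) (hp0 : (p : A) = 0) (hw : w ^ p ^ e = 0)
    (hx : x ^ 2 = v * (v ^ n + w ^ 2)) (hxq : x ^ p ^ e = 0) (hodd : Odd (p ^ e))
    {i l : ℕ} (hi : i ≤ p ^ e) (hl : p ^ e + 2 * n * (p ^ e - i) ≤ l) :
    invariantPart n x v w i l = 0 := by
  obtain ⟨m, hm⟩ := hodd
  set y := v ^ n + w ^ 2 with hy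
  have hpow : (ω : QuadraticAlgebra A y 0) ^ p ^ e * (ω + algebraMap A _ w) ^ (p ^ e - i) =
      algebraMap A _ (v ^ (n * (p ^ e - i))) * ⟨(binomPair w y i).1, (binomPair w y i).2⟩ := by
    rw [← omega_sub_pow_eq hp hp0 hw, ← omega_sub_pow, pow_mul, map_pow,
      ← omega_sub_mul_omega_add _ w _ hy, mul_pow]
    conv_lhs => rw [← Nat.sub_add_cancel hi, pow_add]
    rw [Nat.sub_add_cancel hi]
    ring
  have hq : (ω : QuadraticAlgebra A y 0) ^ p ^ e = algebraMap A _ (y ^ m) * ω := by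
    rw [hm, pow_add, pow_mul, omega_sq, map_pow, pow_one]
  rw [hq] at hpow
  have e1 : x * v ^ m * y ^ m = 0 := by
    rw [mul_assoc, ← mul_pow, ← hx, ← pow_mul, ← pow_succ', ← hm, hxq]
  have e2 : v ^ (m + 1) * y ^ (m + 1) = 0 := by
    rw [← mul_pow, ← hx, ← pow_mul, show 2 * (m + 1) = p ^ e + 1 by omega, pow_succ, hxq, zero_mul]
  have k1 : algebraMap A (QuadraticAlgebra A y 0) (x * v ^ m) *
      (algebraMap A _ (v ^ (n * (p ^ e - i))) * ⟨(binomPair w y i).1, (binomPair w y i).2⟩) = 0 := by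
    rw [← hpow, ← mul_assoc, ← mul_assoc, ← map_mul, e1]; simp
  have k2 : algebraMap A (QuadraticAlgebra A y 0) (v ^ (m + 1)) * (ω *
      (algebraMap A _ (v ^ (n * (p ^ e - i))) *
        ⟨(binomPair w y i).1, (binomPair w y i).2⟩)) = 0 := by
    have h3 : algebraMap A (QuadraticAlgebra A y 0) (v ^ (m + 1)) * algebraMap A _ (y ^ m) *
        ω ^ 2 = 0 := by
      rw [omega_sq, ← map_mul, ← map_mul, mul_assoc, ← pow_succ, e2, map_zero]
    rw [← hpow]
    linear_combination (ω + algebraMap A _ w) ^ (p ^ e - i) * h3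
  have h1 := congrArg QuadraticAlgebra.im k1
  have h2 := congrArg QuadraticAlgebra.im k2
  simp only [← Algebra.smul_def, im_mul, im_smul, re_smul, smul_eq_mul,
    im_zero, omega_re, omega_im, zero_mul, one_mul, zero_add, add_zero] at h1 h2
  have hc : 2 * n * (p ^ e - i) = 2 * (n * (p ^ e - i)) := by ring
  rw [hc] at hl
  rw [invariantPart, ← hy]
  split_ifs with hev
  · obtain ⟨c, hc⟩ : ∃ c, l / 2 = m + 1 + n * (p ^ e - i) + c := by
      refine Nat.exists_eq_add_of_le ?_
      obtain ⟨d, rfl⟩ := hev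
      omega
    rw [hc, pow_add, pow_add]
    linear_combination v ^ c * h2
  · obtain ⟨c, hc⟩ : ∃ c, l / 2 = m + n * (p ^ e - i) + c := by
      refine Nat.exists_eq_add_of_le ?_
      omega
    rw [hc, pow_add, pow_add]
    linear_combination v ^ c * h1

end Reduction

section Spanning

variable {k Q : Type*} [Field k] [CommRing Q] [Algebra k Q]

lemma eq_top_of_forall_X_mul_mem {σ : Type*} (ψ : MvPolynomial σ k →ₐ[k] Q)
    (hψ : Function.Surjective ψ) (M : Submodule k Q) (h1 : 1 ∈ M)
    (hM : ∀ i, ∀ y ∈ M, ψ (X i) * y ∈ M) : M = ⊤ := by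
  rw [eq_top_iff]
  rintro y -
  obtain ⟨f, rfl⟩ := hψ y
  induction f using MvPolynomial.induction_on with
  | C a =>
    rw [← algebraMap_eq, AlgHom.commutes, Algebra.algebraMap_eq_smul_one]
    exact M.smul_mem a h1
  | add f g hf hg => rw [map_add]; exact M.add_mem hf hg
  | mul_X f i hf => rw [map_mul, mul_comm]; exact hM i _ hf

lemma span_range_invariantPart_eq_top (ψ : MvPolynomial (Fin 3) k →ₐ[k] Q)
    (hψ : Function.Surjective ψ) (h2 : (2 : k) ≠ 0) {n : ℕ} {c : k} (hc : c ≠ 0)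
    (hx : (c • ψ (X 0)) ^ 2 = ψ (X 1) * (ψ (X 1) ^ n + ψ (X 2) ^ 2)) :
    Submodule.span k (Set.range fun t : ℕ × ℕ ↦
      invariantPart n (c • ψ (X 0)) (ψ (X 1)) (ψ (X 2)) t.1 t.2) = ⊤ := by
  set M := Submodule.span k (Set.range fun t : ℕ × ℕ ↦
      invariantPart n (c • ψ (X 0)) (ψ (X 1)) (ψ (X 2)) t.1 t.2) with hM
  have mem (i l : ℕ) : invariantPart n (c • ψ (X 0)) (ψ (X 1)) (ψ (X 2)) i l ∈ M :=
    Submodule.subset_span ⟨(i, l), rfl⟩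
  have of_two (y : Q) (hy : 2 * y ∈ M) : y ∈ M := by
    have := M.smul_mem (2 : k)⁻¹ hy
    rwa [two_mul, ← two_smul k y, smul_smul, inv_mul_cancel₀ h2, one_smul] at this
  have of_gen (u : Q) (hu : ∀ i l, u * invariantPart n (c • ψ (X 0)) (ψ (X 1)) (ψ (X 2)) i l ∈ M)
      (y : Q) (hy : y ∈ M) : u * y ∈ M := by
    induction hy using Submodule.span_induction with
    | mem y hy => obtain ⟨t, rfl⟩ := hy; exact hu _ _
    | zero => simp
    | add y z _ _ hy hz => rw [mul_add]; exact M.add_mem hy hz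
    | smul a y _ hy => rw [mul_smul_comm]; exact M.smul_mem a hy
  apply eq_top_of_forall_X_mul_mem ψ hψ
  · simpa [invariantPart, binomPair] using mem 0 0
  · have hX0 := of_gen (c • ψ (X 0)) (fun i l ↦ by
      cases i with
      | zero =>
        rw [x_mul_invariantPart_zero]
        split_ifs
        exacts [mem _ _, M.zero_mem]
      | succ i =>
        apply of_two
        rw [x_mul_invariantPart_succ i l hx]
        exact M.add_mem (mem _ _) (mem _ _))
    intro i
    fin_cases i
    · intro y hy
      have := M.smul_mem c⁻¹ (hX0 y hy)
      rwa [smul_mul_assoc, smul_smul, inv_mul_cancel₀ hc, one_smul] at this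
    · exact of_gen _ fun i l ↦ by
        change ψ (X 1) * _ ∈ M
        rw [v_mul_invariantPart]; exact mem _ _
    · exact of_gen _ fun i l ↦ by
        change ψ (X 2) * _ ∈ M
        cases i with
        | zero =>
          rw [w_mul_invariantPart_zero]
          split_ifs
          exacts [M.neg_mem (mem _ _), M.neg_mem M.zero_mem]
        | succ i =>
          apply of_two
          rw [w_mul_invariantPart_succ]
          exact M.sub_mem (mem _ _) (mem _ _)

/-- The exponents `(i, l)` for which the elements `invariantPart n x v w i l` form a basis of
the quotient by the `q`-th powers. -/
def basisIndex (n q : ℕ) : Finset (Σ _ : ℕ, ℕ) :=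
  (Finset.range (q + 1)).sigma fun i ↦
    {l ∈ Finset.range (min (2 * q) (q + 2 * n * (q - i))) | (i = 0 → Even l) ∧ (i = q → Odd l)}

lemma span_invariantPart_basisIndex_eq_top (ψ : MvPolynomial (Fin 3) k →ₐ[k] Q)
    (hψ : Function.Surjective ψ) (h2 : (2 : k) ≠ 0) {n p e : ℕ} (hp : p.Prime)
    (hp0 : (p : k) = 0) (hodd : Odd (p ^ e)) (hn : 1 ≤ n) {c : k} (hc : c ≠ 0)
    (hx : (c • ψ (X 0)) ^ 2 = ψ (X 1) * (ψ (X 1) ^ n + ψ (X 2) ^ 2))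
    (hu : ψ (X 0) ^ p ^ e = 0) (hv : ψ (X 1) ^ p ^ e = 0) (hw : ψ (X 2) ^ p ^ e = 0) :
    Submodule.span k (Set.range fun t : basisIndex n (p ^ e) ↦
      invariantPart n (c • ψ (X 0)) (ψ (X 1)) (ψ (X 2)) t.1.1 t.1.2) = ⊤ := by
  rw [eq_top_iff, ← span_range_invariantPart_eq_top ψ hψ h2 hc hx, Submodule.span_le]
  have hp0' : (p : Q) = 0 := by rw [← map_natCast (algebraMap k Q), hp0, map_zero]
  have hxq : (c • ψ (X 0)) ^ p ^ e = 0 := by rw [smul_pow, hu, smul_zero]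
  set M := Submodule.span k (Set.range fun t : basisIndex n (p ^ e) ↦
      invariantPart n (c • ψ (X 0)) (ψ (X 1)) (ψ (X 2)) t.1.1 t.1.2)
  have small (i l : ℕ) (hi : i ≤ p ^ e) :
      invariantPart n (c • ψ (X 0)) (ψ (X 1)) (ψ (X 2)) i l ∈ M := by
    by_cases hl : 2 * p ^ e ≤ l
    · rw [invariantPart_eq_zero_of_two_mul_le hv _ hl]; exact M.zero_mem
    by_cases hl' : p ^ e + 2 * n * (p ^ e - i) ≤ l
    · rw [invariantPart_eq_zero_of_add_le hp hp0' hw hx hxq hodd hi hl']; exact M.zero_mem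
    by_cases h0 : i = 0 → Even l
    · by_cases hq : i = p ^ e → Odd l
      · exact Submodule.subset_span ⟨⟨⟨i, l⟩, by
          simp only [basisIndex, Finset.mem_sigma, Finset.mem_range, Finset.mem_filter, lt_min_iff]
          exact ⟨by omega, ⟨by omega, by omega⟩, h0, hq⟩⟩, rfl⟩
      · push Not at hq
        obtain ⟨rfl, hq⟩ := hq
        have h := invariantPart_reflect (n := n) (x := c • ψ (X 0)) (v := ψ (X 1)) hp hp0' hw
          (Nat.zero_le _) l
        rw [Nat.not_odd_iff_even] at hq
        rw [Nat.sub_zero, (hodd.add_even hq).neg_one_pow, mul_zero, mul_zero, add_zero,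
          neg_one_mul, add_zero] at h
        have h' : (2 : k) • invariantPart n (c • ψ (X 0)) (ψ (X 1)) (ψ (X 2)) (p ^ e) l = 0 := by
          rw [two_smul]; nth_rw 1 [h]; exact neg_add_cancel _
        rw [(smul_eq_zero_iff_right h2).1 h']
        exact M.zero_mem
    · push Not at h0
      obtain ⟨rfl, h0⟩ := h0
      simp [invariantPart, binomPair, h0]
  rintro _ ⟨⟨i, l⟩, rfl⟩
  by_cases hi : i ≤ p ^ e
  · exact small i l hi
  by_cases hi' : 2 * p ^ e ≤ i
  · have := invariantPart_eq_zero_of_le (x := c • ψ (X 0)) hp hp0' hw hn hv hi' l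
    simp only [this]
    exact M.zero_mem
  obtain ⟨j, rfl⟩ := Nat.exists_eq_add_of_le (le_of_not_ge hi)
  simp only [SetLike.mem_coe]
  rw [invariantPart_reflect hp hp0' hw (by omega)]
  rcases neg_one_pow_eq_or Q (p ^ e - j + l) with h | h <;> rw [h]
  · rw [one_mul]; exact small _ _ (by omega)
  · rw [neg_one_mul]; exact M.neg_mem (small _ _ (by omega))

end Spanning

section Model

lemma finrank_eq_card_of_dual {k V Q ι : Type*} [Field k] [AddCommGroup V] [Module k V]
    [AddCommGroup Q] [Module k Q] [Fintype ι] (ψ : V →ₗ[k] Q) (b : ι → V)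
    (hspan : Submodule.span k (Set.range fun i ↦ ψ (b i)) = ⊤) (d : ι → V →ₗ[k] k)
    (hker : ∀ f, ψ f = 0 → ∀ i, d i f = 0) (hdiag : ∀ i, d i (b i) ≠ 0)
    (hoff : ∀ i j, i ≠ j → d i (b j) = 0) : Module.finrank k Q = Fintype.card ι := by
  have hli : LinearIndependent k fun i ↦ ψ (b i) := by
    rw [Fintype.linearIndependent_iff]
    intro g hg i
    have h := hker (∑ j, g j • b j) (by simpa using hg) i
    rw [map_sum, Finset.sum_eq_single i] at h
    · simpa [hdiag i] using h
    · intro j _ hj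
      rw [map_smul, hoff i j hj.symm, smul_zero]
    · simp
  exact Module.finrank_eq_card_basis (Module.Basis.mk hli hspan.ge)

variable {n q : ℕ}

lemma le_add_of_cast_eq_sub {i x y : ℕ} (hi : i ≤ q) (h : (i : ZMod (2 * q)) = x - y) :
    i ≤ x + y := by
  have h' : ((i + y : ℕ) : ZMod (2 * q)) = (x : ℕ) := by push_cast; rw [h]; ring
  rw [ZMod.natCast_eq_natCast_iff, Nat.modEq_iff_dvd] at h'
  obtain ⟨a, ha⟩ := h'
  push_cast at ha
  rcases le_or_gt 0 a with h0 | h0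
  · have : 0 ≤ 2 * (q : ℤ) * a := by positivity
    omega
  · have : 2 * (q : ℤ) * a ≤ 2 * (q : ℤ) * (-1) :=
      mul_le_mul_of_nonneg_left (by omega) (by positivity)
    omega

lemma sub_le_add_of_cast_eq_add_sub {i x y : ℕ} (hi : i ≤ q)
    (h : (i : ZMod (2 * q)) = q + x - y) : q - i ≤ x + y := by
  rw [add_comm x]
  refine le_add_of_cast_eq_sub (q := q) (by omega) ?_
  rw [Nat.cast_sub hi, h]
  ring

lemma cast_inj_of_le (hq : 0 < q) {i j : ℕ} (hi : i ≤ q) (hj : j ≤ q)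
    (h : (i : ZMod (2 * q)) = j) : i = j := by
  rw [ZMod.natCast_eq_natCast_iff] at h
  exact h.eq_of_lt_of_lt (by omega) (by omega)

lemma eq_neg_cast_iff (hq : 0 < q) {i j : ℕ} (hi : i ≤ q) (hj : j ≤ q) :
    -(j : ZMod (2 * q)) = i ↔ i = j ∧ (i = 0 ∨ i = q) := by
  rw [neg_eq_iff_add_eq_zero, ← Nat.cast_add, ZMod.natCast_eq_zero_iff]
  constructor
  · rintro ⟨a, ha⟩
    have : a < 2 := by
      by_contra! h
      have := Nat.mul_le_mul_left (2 * q) h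
      omega
    interval_cases a <;> omega
  · rintro ⟨rfl, rfl | rfl⟩
    · simp
    · exact ⟨1, by ring⟩

variable {k : Type*} [Field k]

/-- The monomial `ν ^ a * z ^ b` of `k[ν][z] / (z ^ (2 * q) - 1)`. -/
abbrev cyclicMonomial (k : Type*) [Field k] (q a : ℕ) (b : ZMod (2 * q)) :
    AddMonoidAlgebra k (ℕ × ZMod (2 * q)) :=
  AddMonoidAlgebra.single (a, b) 1

lemma cyclicMonomial_mul (a a' : ℕ) (b b' : ZMod (2 * q)) :
    cyclicMonomial k q a b * cyclicMonomial k q a' b' = cyclicMonomial k q (a + a') (b + b') := by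
  simp [AddMonoidAlgebra.single_mul_single]

lemma cyclicMonomial_pow (a : ℕ) (b : ZMod (2 * q)) (i : ℕ) :
    cyclicMonomial k q a b ^ i = cyclicMonomial k q (i * a) (i * b) := by
  simp [AddMonoidAlgebra.single_pow]

/-- The span of the monomials generated by `ν ^ (2 * q)` and `ν ^ q * s ^ q` over the monoid
generated by `ν`, `s = ν ^ n * z` and `t = ν ^ n * z⁻¹`. -/
def monomialSpan (k : Type*) [Field k] (n q : ℕ) :
    Submodule k (AddMonoidAlgebra k (ℕ × ZMod (2 * q))) :=
  Submodule.span k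
    (Set.range (fun d : ℕ × ℕ × ℕ ↦ cyclicMonomial k q
      (d.1 + 2 * q + n * (d.2.1 + d.2.2)) (d.2.1 - d.2.2)) ∪
    Set.range (fun d : ℕ × ℕ × ℕ ↦ cyclicMonomial k q
      (d.1 + q + n * (q + d.2.1 + d.2.2)) (q + d.2.1 - d.2.2)))

lemma coeff_eq_zero_of_mem_monomialSpan {f : AddMonoidAlgebra k (ℕ × ZMod (2 * q))}
    (hf : f ∈ monomialSpan k n q) {i l : ℕ} (hi : i ≤ q) (hl : l < 2 * q)
    (hl' : l < q + 2 * n * (q - i)) : f.coeff (l + n * i, (i : ZMod (2 * q))) = 0 := by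
  induction hf using Submodule.span_induction with
  | mem f hf =>
    rcases hf with ⟨⟨a, x, y⟩, rfl⟩ | ⟨⟨a, x, y⟩, rfl⟩
    · refine Finsupp.single_eq_of_ne fun h ↦ ?_
      rw [Prod.mk.injEq] at h
      have := Nat.mul_le_mul_left n (le_add_of_cast_eq_sub hi h.2)
      have := h.1
      dsimp only at this
      omega
    · refine Finsupp.single_eq_of_ne fun h ↦ ?_
      rw [Prod.mk.injEq] at h
      have h2 := Nat.mul_le_mul_left n (sub_le_add_of_cast_eq_add_sub hi h.2)
      have h1 := h.1
      dsimp only at h1 h2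
      have h3 : n * q = n * i + n * (q - i) := by rw [← mul_add]; congr 1; omega
      rw [add_assoc q, mul_add n q] at h1
      have h4 : 2 * n * (q - i) = 2 * (n * (q - i)) := by ring
      omega
  | zero => simp
  | add f g _ _ hf hg => simp [hf, hg]
  | smul a f _ hf => simp [hf]

lemma mul_mem_monomialSpan {f g : AddMonoidAlgebra k (ℕ × ZMod (2 * q))}
    (hg : g = cyclicMonomial k q 1 0 ∨ g = cyclicMonomial k q n 1 ∨ g = cyclicMonomial k q n (-1))
    (hf : f ∈ monomialSpan k n q) : g * f ∈ monomialSpan k n q := by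
  induction hf using Submodule.span_induction with
  | mem f hf =>
    apply Submodule.subset_span
    rcases hf with ⟨⟨a, x, y⟩, rfl⟩ | ⟨⟨a, x, y⟩, rfl⟩
    · left
      rcases hg with rfl | rfl | rfl <;> dsimp only <;> rw [cyclicMonomial_mul]
      · exact ⟨⟨a + 1, x, y⟩, by dsimp only; congr 1 <;> ring⟩
      · exact ⟨⟨a, x + 1, y⟩, by dsimp only; congr 1 <;> push_cast <;> ring⟩
      · exact ⟨⟨a, x, y + 1⟩, by dsimp only; congr 1 <;> push_cast <;> ring⟩
    · right
      rcases hg with rfl | rfl | rfl <;> dsimp only <;> rw [cyclicMonomial_mul]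
      · exact ⟨⟨a + 1, x, y⟩, by dsimp only; congr 1 <;> ring⟩
      · exact ⟨⟨a, x + 1, y⟩, by dsimp only; congr 1 <;> push_cast <;> ring⟩
      · exact ⟨⟨a, x, y + 1⟩, by dsimp only; congr 1 <;> push_cast <;> ring⟩
  | zero => simp
  | add f g _ _ hf hg => rw [mul_add]; exact Submodule.add_mem _ hf hg
  | smul a f _ hf => rw [mul_smul_comm]; exact Submodule.smul_mem _ a hf

/-- The homomorphism `U ↦ -c ν β`, `V ↦ ν ^ 2`, `W ↦ α`, where `β = (s + t) / 2` and
`α = (t - s) / 2` for `s = ν ^ n * z` and `t = ν ^ n * z⁻¹`. -/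
def toCyclic (n q : ℕ) (c : k) :
    MvPolynomial (Fin 3) k →ₐ[k] AddMonoidAlgebra k (ℕ × ZMod (2 * q)) :=
  aeval ![-c • (cyclicMonomial k q 1 0 * (algebraMap k _ 2⁻¹ *
      (cyclicMonomial k q n 1 + cyclicMonomial k q n (-1)))),
    cyclicMonomial k q 1 0 ^ 2,
    algebraMap k _ 2⁻¹ * (cyclicMonomial k q n (-1) - cyclicMonomial k q n 1)]

lemma two_mul_algebraMap_inv (A : Type*) [CommRing A] [Algebra k A] (h2 : (2 : k) ≠ 0) :
    2 * algebraMap k A 2⁻¹ = 1 := by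
  rw [← map_ofNat (algebraMap k A) 2, ← map_mul, mul_inv_cancel₀ h2, map_one]

lemma cyclicMonomial_mul_neg (n q : ℕ) :
    cyclicMonomial k q n 1 * cyclicMonomial k q n (-1) = cyclicMonomial k q 1 0 ^ (2 * n) := by
  rw [cyclicMonomial_mul, cyclicMonomial_pow]
  congr 1
  · ring
  · simp

lemma toCyclic_mul_mem (c : k) (g : MvPolynomial (Fin 3) k)
    {f : AddMonoidAlgebra k (ℕ × ZMod (2 * q))} (hf : f ∈ monomialSpan k n q) :
    toCyclic n q c g * f ∈ monomialSpan k n q := by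
  induction g using MvPolynomial.induction_on generalizing f with
  | C a =>
    rw [← algebraMap_eq, AlgHom.commutes, ← Algebra.smul_def]
    exact Submodule.smul_mem _ a hf
  | add g g' hg hg' => rw [map_add, add_mul]; exact Submodule.add_mem _ (hg hf) (hg' hf)
  | mul_X g i hg =>
    rw [map_mul, mul_assoc]
    apply hg
    have hν {f} (hf : f ∈ monomialSpan k n q) : cyclicMonomial k q 1 0 * f ∈ monomialSpan k n q :=
      mul_mem_monomialSpan (.inl rfl) hf
    have hs := mul_mem_monomialSpan (.inr (.inl rfl)) hf
    have ht := mul_mem_monomialSpan (.inr (.inr rfl)) hf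
    fin_cases i
    · simp only [toCyclic, aeval_X, Fin.zero_eta, Matrix.cons_val_zero, smul_mul_assoc]
      rw [mul_assoc, mul_assoc, ← Algebra.smul_def, mul_smul_comm, add_mul]
      exact Submodule.smul_mem _ _ (Submodule.smul_mem _ _ (hν (Submodule.add_mem _ hs ht)))
    · simp only [toCyclic, aeval_X, Fin.mk_one, Matrix.cons_val_one, Matrix.cons_val_zero]
      rw [pow_two, mul_assoc]
      exact hν (hν hf)
    · simp only [toCyclic, aeval_X, Fin.reduceFinMk, Matrix.cons_val]
      rw [mul_assoc, ← Algebra.smul_def, sub_mul]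
      exact Submodule.smul_mem _ _ (Submodule.sub_mem _ ht hs)

lemma toCyclic_rel (h2 : (2 : k) ≠ 0) {c : k} (hc : c ^ 2 = -1) :
    toCyclic n q c (X 0 ^ 2 + X 1 ^ (n + 1) + X 1 * X 2 ^ 2) = 0 := by
  have hst := cyclicMonomial_mul_neg (k := k) n q
  have hh := two_mul_algebraMap_inv (AddMonoidAlgebra k (ℕ × ZMod (2 * q))) h2
  simp only [toCyclic, map_add, map_mul, map_pow, aeval_X, Matrix.cons_val_zero,
    Matrix.cons_val_one, Matrix.cons_val, smul_pow, neg_sq, hc]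
  rw [neg_one_smul]
  generalize cyclicMonomial k q 1 0 = ν at *
  generalize cyclicMonomial k q n 1 = s at *
  generalize cyclicMonomial k q n (-1) = t at *
  generalize algebraMap k (AddMonoidAlgebra k (ℕ × ZMod (2 * q))) 2⁻¹ = h at *
  rw [← pow_mul, mul_add 2, pow_add, ← hst]
  linear_combination (-(ν ^ 2 * s * t) * (1 + 2 * h)) * hh

lemma cyclicMonomial_pow_self (n q : ℕ) :
    cyclicMonomial k q n (-1) ^ q = cyclicMonomial k q n 1 ^ q := by
  rw [cyclicMonomial_pow, cyclicMonomial_pow]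
  congr 1
  rw [mul_neg_one, mul_one, neg_eq_iff_add_eq_zero, ← Nat.cast_add, ← two_mul,
    ZMod.natCast_self]

lemma toCyclic_mem_of_mem_span {p e : ℕ} (hp : p.Prime) [CharP k p] (h2 : (2 : k) ≠ 0) {c : k}
    (hc : c ^ 2 = -1) {f : MvPolynomial (Fin 3) k}
    (hf : f ∈ Ideal.span {X 0 ^ 2 + X 1 ^ (n + 1) + X 1 * X 2 ^ 2, X 0 ^ p ^ e, X 1 ^ p ^ e,
      X 2 ^ p ^ e}) : toCyclic n (p ^ e) c f ∈ monomialSpan k n (p ^ e) := by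
  have : Fact p.Prime := ⟨hp⟩
  have : CharP (AddMonoidAlgebra k (ℕ × ZMod (2 * p ^ e))) p :=
    charP_of_injective_algebraMap (FaithfulSMul.algebraMap_injective k _) p
  induction hf using Submodule.span_induction with
  | mem f hf =>
    rcases hf with rfl | rfl | rfl | rfl
    · rw [toCyclic_rel h2 hc]; exact Submodule.zero_mem _
    · simp only [toCyclic, map_pow, aeval_X, Matrix.cons_val_zero]
      rw [smul_pow, mul_pow, mul_pow, add_pow_char_pow, cyclicMonomial_pow_self, ← map_pow,
        ← two_smul k, ← Algebra.smul_def, cyclicMonomial_pow, cyclicMonomial_pow,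
        mul_smul_comm, mul_smul_comm, cyclicMonomial_mul]
      refine Submodule.smul_mem _ _ (Submodule.smul_mem _ _ (Submodule.smul_mem _ _
        (Submodule.subset_span (.inr ⟨(0, 0, 0), ?_⟩))))
      dsimp only
      congr 1 <;> push_cast <;> ring
    · simp only [toCyclic, map_pow, aeval_X, Matrix.cons_val_one, Matrix.cons_val_zero]
      rw [← pow_mul, cyclicMonomial_pow]
      refine Submodule.subset_span (.inl ⟨(0, 0, 0), ?_⟩)
      dsimp only
      congr 1; push_cast; ring
    · simp only [toCyclic, map_pow, aeval_X, Matrix.cons_val]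
      rw [mul_pow, sub_pow_char_pow, cyclicMonomial_pow_self, sub_self, mul_zero]
      exact Submodule.zero_mem _
  | zero => rw [map_zero]; exact Submodule.zero_mem _
  | add f g _ _ hf hg => rw [map_add]; exact Submodule.add_mem _ hf hg
  | smul a f _ hf => rw [smul_eq_mul, map_mul]; exact toCyclic_mul_mem c a hf

lemma toCyclic_invariantPart (h2 : (2 : k) ≠ 0) {c : k} (hc : c ^ 2 = -1) (i l : ℕ) :
    toCyclic n q c (invariantPart n (c • X 0) (X 1) (X 2) i l) =
      (2⁻¹ : k) • (cyclicMonomial k q (l + n * i) i +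
        (-1 : k) ^ (i + l) • cyclicMonomial k q (l + n * i) (-i)) := by
  have h0 : toCyclic n q c (c • X 0) = cyclicMonomial k q 1 0 * (algebraMap k _ 2⁻¹ *
      (cyclicMonomial k q n 1 + cyclicMonomial k q n (-1))) := by
    rw [map_smul]
    simp only [toCyclic, aeval_X, Matrix.cons_val_zero]
    rw [smul_smul, mul_neg, ← pow_two, hc, neg_neg, one_smul]
  have h := map_invariantPart (toCyclic n q c).toRingHom n (c • X 0) (X 1) (X 2) i l
  simp only [AlgHom.toRingHom_eq_coe, RingHom.coe_coe] at h
  rw [h, h0]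
  have h1 : toCyclic n q c (X 1) = cyclicMonomial k q 1 0 ^ 2 := by simp [toCyclic]
  have h3 : toCyclic n q c (X 2) = algebraMap k _ 2⁻¹ *
    (cyclicMonomial k q n (-1) - cyclicMonomial k q n 1) := by simp [toCyclic]
  rw [h1, h3, invariantPart_eq n (two_mul_algebraMap_inv _ h2) (cyclicMonomial_mul_neg n q),
    ← Algebra.smul_def, cyclicMonomial_pow, cyclicMonomial_pow, cyclicMonomial_pow, mul_add,
    mul_left_comm, cyclicMonomial_mul, cyclicMonomial_mul, Algebra.smul_def ((-1 : k) ^ (i + l)),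
    map_pow, map_neg, map_one]
  congr 4 <;> simp [mul_comm]

end Model

section Finrank

variable {k Q : Type*} [Field k] [CommRing Q] [Algebra k Q]

/-- The functional `f ↦ coeff m f` on an additive monoid algebra. -/
def cyclicCoeff {M : Type*} (m : M) : AddMonoidAlgebra k M →ₗ[k] k where
  toFun f := f.coeff m
  map_add' _ _ := rfl
  map_smul' _ _ := rfl

lemma coeff_toCyclic_invariantPart {n q : ℕ} (h2 : (2 : k) ≠ 0) {c : k} (hc : c ^ 2 = -1)
    (i l a : ℕ) (b : ZMod (2 * q)) :
    (toCyclic n q c (invariantPart n (c • X 0) (X 1) (X 2) i l)).coeff (a, b) =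
      2⁻¹ * ((if l + n * i = a ∧ (i : ZMod (2 * q)) = b then 1 else 0) +
        (-1) ^ (i + l) * (if l + n * i = a ∧ -(i : ZMod (2 * q)) = b then 1 else 0)) := by
  rw [toCyclic_invariantPart h2 hc]
  simp only [AddMonoidAlgebra.coeff_smul, AddMonoidAlgebra.coeff_add,
    AddMonoidAlgebra.coeff_single, Finsupp.smul_apply, Finsupp.add_apply, Finsupp.single_apply,
    Prod.mk.injEq, smul_eq_mul]

lemma finrank_eq_card_basisIndex (ψ : MvPolynomial (Fin 3) k →ₐ[k] Q)
    (hψ : Function.Surjective ψ) (h2 : (2 : k) ≠ 0) {n p e : ℕ} (hp : p.Prime)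
    [CharP k p] (hodd : Odd (p ^ e)) (hn : 1 ≤ n) {c : k} (hc : c ^ 2 = -1)
    (hker : RingHom.ker ψ = Ideal.span {X 0 ^ 2 + X 1 ^ (n + 1) + X 1 * X 2 ^ 2,
      X 0 ^ p ^ e, X 1 ^ p ^ e, X 2 ^ p ^ e}) :
    Module.finrank k Q = (basisIndex n (p ^ e)).card := by
  have hc0 : c ≠ 0 := by rintro rfl; simp at hc
  have hq : 0 < p ^ e := pow_pos hp.pos e
  have hmem {f : MvPolynomial (Fin 3) k} (hf : f ∈ ({X 0 ^ 2 + X 1 ^ (n + 1) + X 1 * X 2 ^ 2,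
      X 0 ^ p ^ e, X 1 ^ p ^ e, X 2 ^ p ^ e} : Set (MvPolynomial (Fin 3) k))) : ψ f = 0 := by
    rw [← RingHom.mem_ker, hker]; exact Ideal.subset_span hf
  have hrel := hmem (f := X 0 ^ 2 + X 1 ^ (n + 1) + X 1 * X 2 ^ 2) (by simp)
  simp only [map_add, map_mul, map_pow] at hrel
  have hspan := span_invariantPart_basisIndex_eq_top ψ hψ h2 (n := n) (p := p) (e := e) hp
    (CharP.cast_eq_zero k p) hodd hn (c := c) hc0
    (by rw [smul_pow, hc, neg_one_smul]; linear_combination -hrel)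
    (by rw [← map_pow]; exact hmem (by simp)) (by rw [← map_pow]; exact hmem (by simp))
    (by rw [← map_pow]; exact hmem (by simp))
  rw [← Fintype.card_coe]
  refine finrank_eq_card_of_dual ψ.toLinearMap
    (fun t : basisIndex n (p ^ e) ↦ invariantPart n (c • X 0) (X 1) (X 2) t.1.1 t.1.2) ?_
    (fun t ↦ (cyclicCoeff (t.1.2 + n * t.1.1, (t.1.1 : ZMod (2 * p ^ e)))).comp
      (toCyclic n (p ^ e) c).toLinearMap) ?_ ?_ ?_
  · rw [← hspan]
    congr 2
    ext t
    have := map_invariantPart ψ.toRingHom n (c • X 0) (X 1) (X 2) t.1.1 t.1.2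
    simpa using this
  · rintro f hf ⟨⟨i, l⟩, ht⟩
    simp only [basisIndex, Finset.mem_sigma, Finset.mem_range, Finset.mem_filter,
      lt_min_iff] at ht
    rw [AlgHom.toLinearMap_apply, ← RingHom.mem_ker, hker] at hf
    exact coeff_eq_zero_of_mem_monomialSpan (toCyclic_mem_of_mem_span hp h2 hc hf)
      (Nat.lt_succ_iff.1 ht.1) ht.2.1.1 ht.2.1.2
  · rintro ⟨⟨i, l⟩, ht⟩
    simp only [basisIndex, Finset.mem_sigma, Finset.mem_range, Finset.mem_filter] at ht
    change (toCyclic n (p ^ e) c (invariantPart n (c • X 0) (X 1) (X 2) i l)).coeff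
      (l + n * i, (i : ZMod (2 * p ^ e))) ≠ 0
    rw [coeff_toCyclic_invariantPart h2 hc]
    simp only [true_and, if_true]
    have hi : i ≤ p ^ e := by omega
    simp only [eq_neg_cast_iff hq hi hi]
    refine mul_ne_zero (inv_ne_zero h2) ?_
    split_ifs with h
    · have : Even (i + l) := by
        rcases h.2 with h | h
        · rw [h, zero_add]; exact ht.2.2.1 h
        · rw [h]; exact hodd.add_odd (ht.2.2.2 h)
      rw [this.neg_one_pow, mul_one, one_add_one_eq_two]
      exact h2
    · simp
  · rintro ⟨⟨i, l⟩, ht⟩ ⟨⟨j, l'⟩, ht'⟩ hne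
    simp only [basisIndex, Finset.mem_sigma, Finset.mem_range, Finset.mem_filter] at ht ht'
    change (toCyclic n (p ^ e) c (invariantPart n (c • X 0) (X 1) (X 2) j l')).coeff
      (l + n * i, (i : ZMod (2 * p ^ e))) = 0
    rw [coeff_toCyclic_invariantPart h2 hc]
    have hi : i ≤ p ^ e := by omega
    have hj : j ≤ p ^ e := by omega
    simp only [eq_neg_cast_iff hq hi hj]
    rw [if_neg, if_neg]
    · simp
    · rintro ⟨h1, rfl, -⟩
      obtain rfl : l' = l := by omega
      exact hne rfl
    · rintro ⟨h1, h3⟩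
      obtain rfl := cast_inj_of_le hq hj hi h3
      obtain rfl : l' = l := by omega
      exact hne rfl

lemma card_filter_even_range (m : ℕ) : (Finset.filter Even (Finset.range (2 * m))).card = m := by
  induction m with
  | zero => simp
  | succ m ih =>
    rw [mul_add_one, Finset.range_add_one, Finset.filter_insert, Finset.range_add_one,
      Finset.filter_insert, if_neg (by simp), if_pos (by simp),
      Finset.card_insert_of_notMem (by simp), ih]

lemma card_filter_odd_range (m : ℕ) :
    (Finset.filter Odd (Finset.range (2 * m + 1))).card = m := by
  induction m with
  | zero => simp
  | succ m ih =>
    rw [mul_add_one, Finset.range_add_one, Finset.filter_insert, Finset.range_add_one,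
      Finset.filter_insert, if_neg (by simp [Nat.odd_add_one]),
      if_pos (by simp),
      Finset.card_insert_of_notMem (by simp), ih]

lemma card_basisIndex {n : ℕ} (hn : 1 ≤ n) (m : ℕ) :
    (basisIndex n (2 * m + 1)).card = (2 * m + 1) + m +
      ∑ a ∈ Finset.range (2 * m), min (2 * (2 * m + 1)) (2 * m + 1 + 2 * n * (a + 1)) := by
  rw [basisIndex, Finset.card_sigma, Finset.sum_range_succ, Finset.sum_range_succ',
    ← Finset.sum_range_reflect]
  have h0 : min (2 * (2 * m + 1)) (2 * m + 1 + 2 * n * (2 * m + 1 - 0)) = 2 * (2 * m + 1) := by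
    have := Nat.mul_le_mul_right (2 * m + 1) hn
    rw [min_eq_left]
    rw [Nat.sub_zero, mul_assoc 2 n]
    omega
  have hlast : min (2 * (2 * m + 1)) (2 * m + 1 + 2 * n * (2 * m + 1 - (2 * m + 1))) =
      2 * m + 1 := by
    rw [Nat.sub_self, mul_zero]; omega
  rw [h0, hlast]
  have e1 : Finset.filter (fun l ↦ (0 = 0 → Even l) ∧ (0 = 2 * m + 1 → Odd l))
      (Finset.range (2 * (2 * m + 1))) = Finset.filter Even (Finset.range (2 * (2 * m + 1))) := by
    simp
  have e2 : Finset.filter (fun l ↦ (2 * m + 1 = 0 → Even l) ∧ (2 * m + 1 = 2 * m + 1 → Odd l))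
      (Finset.range (2 * m + 1)) = Finset.filter Odd (Finset.range (2 * m + 1)) := by
    simp
  rw [e1, e2, card_filter_even_range, card_filter_odd_range]
  rw [Finset.sum_congr rfl (g := fun a ↦ min (2 * (2 * m + 1)) (2 * m + 1 + 2 * n * (a + 1)))]
  · ring
  · intro a ha
    rw [Finset.mem_range] at ha
    rw [Finset.filter_true_of_mem, Finset.card_range]
    · congr 3
      omega
    · intro l _
      exact ⟨fun h ↦ by omega, fun h ↦ by omega⟩

lemma sum_min_eq (n q b : ℕ) {N : ℕ} (hN : q / (2 * n) + b = N) (hn : 1 ≤ n) :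
    ∑ a ∈ Finset.range N, min (2 * q) (q + 2 * n * (a + 1)) =
      (q / (2 * n)) * q + n * (q / (2 * n)) * (q / (2 * n) + 1) + b * (2 * q) := by
  subst hN
  induction b with
  | zero =>
    have h (a : ℕ) (ha : a ∈ Finset.range (q / (2 * n))) :
        min (2 * q) (q + 2 * n * (a + 1)) = q + 2 * n * (a + 1) := by
      rw [Finset.mem_range] at ha
      have := Nat.mul_le_mul_left (2 * n) (Nat.succ_le_of_lt ha)
      have := Nat.mul_div_le q (2 * n)
      rw [min_eq_right]
      simp only [Nat.succ_eq_add_one] at *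
      omega
    rw [add_zero, Finset.sum_congr rfl h]
    generalize q / (2 * n) = h'
    clear h
    induction h' with
    | zero => simp
    | succ d ih => rw [Finset.sum_range_succ, ih]; ring
  | succ b ih =>
    rw [← add_assoc, Finset.sum_range_succ, ih, min_eq_left]
    · ring
    · have := Nat.lt_mul_div_succ q (show 0 < 2 * n by omega)
      have := Nat.mul_le_mul_left (2 * n) (show q / (2 * n) + 1 ≤ q / (2 * n) + b + 1 by omega)
      omega

lemma card_basisIndex_eq {n q : ℕ} (hn : 2 ≤ n) (hodd : Odd q) :
    ((basisIndex n q).card : ℚ) = (2 - 1 / (4 * (n : ℚ))) * (q : ℚ) ^ 2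
      - (((q % (2 * n) : ℕ) : ℚ) + 1) / 2 + ((q % (2 * n) : ℕ) : ℚ) ^ 2 / (4 * (n : ℚ)) := by
  obtain ⟨m, rfl⟩ := hodd
  have hle : (2 * m + 1) / (2 * n) ≤ 2 * m := by
    have : (2 * m + 1) / (2 * n) ≤ (2 * m + 1) / 2 :=
      Nat.div_le_div_left (show 2 ≤ 2 * n by omega) (by omega)
    omega
  obtain ⟨b, hb⟩ := Nat.exists_eq_add_of_le hle
  rw [card_basisIndex (by omega), sum_min_eq n _ b hb.symm (by omega)]
  have hdiv := Nat.div_add_mod (2 * m + 1) (2 * n)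
  generalize (2 * m + 1) / (2 * n) = h at *
  generalize (2 * m + 1) % (2 * n) = r at *
  have hn0 : (n : ℚ) ≠ 0 := by positivity
  have hdiv' : (2 * n * h + r : ℚ) = 2 * m + 1 := by exact_mod_cast hdiv
  have hb' : (b : ℚ) = 2 * m - h := by rw [eq_sub_iff_add_eq']; exact_mod_cast hb.symm
  have hr : (r : ℚ) = 2 * m + 1 - 2 * n * h := by linear_combination hdiv'
  push_cast
  rw [hb', hr]
  field_simp
  ring

end Finrank

section CharTwo

variable {k Q : Type*} [Field k] [CommRing Q] [Algebra k Q]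

lemma coeff_eq_zero_of_mem_span_pair {q : ℕ} {f : MvPolynomial (Fin 2) k}
    (hf : f ∈ Ideal.span {(X 0 ^ q : MvPolynomial (Fin 2) k), X 1 ^ q}) {m : Fin 2 →₀ ℕ}
    (h0 : m 0 < q) (h1 : m 1 < q) : f.coeff m = 0 := by
  obtain ⟨a, b, rfl⟩ := Ideal.mem_span_pair.1 hf
  rw [coeff_add, X_pow_eq_monomial, X_pow_eq_monomial, coeff_mul_monomial', coeff_mul_monomial',
    if_neg, if_neg, add_zero]
  · intro h
    have := h 1
    simp at this
    omega
  · intro h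
    have := h 0
    simp at this
    omega

/-- The homomorphism `U ↦ ω`, `V ↦ X 0`, `W ↦ X 1` to `k[X 0, X 1][ω]` with
`ω ^ 2 = -(X 0 ^ (n + 1) + X 0 * X 1 ^ 2)`. -/
def toQuadratic (k : Type*) [Field k] (n : ℕ) : MvPolynomial (Fin 3) k →ₐ[k]
    QuadraticAlgebra (MvPolynomial (Fin 2) k) (-(X 0 ^ (n + 1) + X 0 * X 1 ^ 2)) 0 :=
  aeval ![QuadraticAlgebra.omega, algebraMap (MvPolynomial (Fin 2) k) _ (X 0),
    algebraMap (MvPolynomial (Fin 2) k) _ (X 1)]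

lemma re_mem_and_im_mem_of_mem_map {A : Type*} [CommRing A] {a b : A} {J : Ideal A}
    {z : QuadraticAlgebra A a b} (hz : z ∈ J.map (algebraMap A (QuadraticAlgebra A a b))) :
    z.re ∈ J ∧ z.im ∈ J := by
  induction hz using Submodule.span_induction with
  | mem z hz =>
    obtain ⟨y, hy, rfl⟩ := hz
    exact ⟨by simpa using hy, by simp⟩
  | zero => simp
  | add z z' _ _ h h' => exact ⟨J.add_mem h.1 h'.1, J.add_mem h.2 h'.2⟩
  | smul y z _ h =>
    rw [smul_eq_mul, QuadraticAlgebra.re_mul, QuadraticAlgebra.im_mul]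
    exact ⟨J.add_mem (J.mul_mem_left _ h.1) (J.mul_mem_left _ h.2),
      J.add_mem (J.add_mem (J.mul_mem_left _ h.2) (J.mul_mem_left _ h.1))
        (J.mul_mem_left _ h.2)⟩

lemma toQuadratic_mem_of_mem_span [CharP k 2] {n e : ℕ} (hn : 1 ≤ n) {f : MvPolynomial (Fin 3) k}
    (hf : f ∈ Ideal.span {X 0 ^ 2 + X 1 ^ (n + 1) + X 1 * X 2 ^ 2, X 0 ^ 2 ^ (e + 1),
      X 1 ^ 2 ^ (e + 1), X 2 ^ 2 ^ (e + 1)}) :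
    toQuadratic k n f ∈ (Ideal.span {(X 0 ^ 2 ^ (e + 1) : MvPolynomial (Fin 2) k),
      X 1 ^ 2 ^ (e + 1)}).map (algebraMap (MvPolynomial (Fin 2) k) _) := by
  rw [← Ideal.mem_comap]
  revert f
  change Ideal.span _ ≤ _
  have hsq : (QuadraticAlgebra.omega : QuadraticAlgebra (MvPolynomial (Fin 2) k)
      (-(X 0 ^ (n + 1) + X 0 * X 1 ^ 2)) 0) ^ 2 =
      algebraMap (MvPolynomial (Fin 2) k) _ (-(X 0 ^ (n + 1) + X 0 * X 1 ^ 2)) :=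
    omega_sq _
  rw [Ideal.span_le]
  rintro f (rfl | rfl | rfl | rfl) <;> rw [SetLike.mem_coe, Ideal.mem_comap]
  · have : toQuadratic k n (X 0 ^ 2 + X 1 ^ (n + 1) + X 1 * X 2 ^ 2) = 0 := by
      simp only [toQuadratic, map_add, map_mul, map_pow, aeval_X, Matrix.cons_val_zero,
        Matrix.cons_val_one, Matrix.cons_val, hsq, map_neg]
      ring
    rw [this]
    exact Ideal.zero_mem _
  · simp only [toQuadratic, map_pow, aeval_X, Matrix.cons_val_zero]
    rw [pow_succ' 2 e, pow_mul QuadraticAlgebra.omega, hsq, ← map_pow]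
    apply Ideal.mem_map_of_mem
    rw [neg_pow, add_pow_char_pow, ← pow_mul, mul_pow, ← pow_mul]
    refine Ideal.mul_mem_left _ _ (Ideal.add_mem _ ?_ ?_)
    · refine Ideal.pow_mem_of_pow_mem _ ?_ (Nat.mul_le_mul_right (2 ^ e) (show 2 ≤ n + 1 by omega))
      exact Ideal.subset_span (by simp)
    · exact Ideal.mul_mem_left _ _ (Ideal.subset_span (by simp))
  · simp only [toQuadratic, map_pow, aeval_X, Matrix.cons_val_one, Matrix.cons_val_zero]
    rw [← map_pow]
    exact Ideal.mem_map_of_mem _ (Ideal.subset_span (by simp))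
  · simp only [toQuadratic, map_pow, aeval_X, Matrix.cons_val]
    rw [← map_pow]
    exact Ideal.mem_map_of_mem _ (Ideal.subset_span (by simp))

lemma span_monomials_eq_top (ψ : MvPolynomial (Fin 3) k →ₐ[k] Q) (hψ : Function.Surjective ψ)
    {n q : ℕ} (hrel : ψ (X 0) ^ 2 + ψ (X 1) ^ (n + 1) + ψ (X 1) * ψ (X 2) ^ 2 = 0)
    (h1 : ψ (X 1) ^ q = 0) (h2 : ψ (X 2) ^ q = 0) :
    Submodule.span k (Set.range fun t : Fin 2 × Fin q × Fin q ↦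
      ψ (X 0 ^ (t.1 : ℕ) * X 1 ^ (t.2.1 : ℕ) * X 2 ^ (t.2.2 : ℕ))) = ⊤ := by
  set M := Submodule.span k (Set.range fun t : Fin 2 × Fin q × Fin q ↦
      ψ (X 0 ^ (t.1 : ℕ) * X 1 ^ (t.2.1 : ℕ) * X 2 ^ (t.2.2 : ℕ))) with hM
  have mem (a : Fin 2) (i j : ℕ) : ψ (X 0) ^ (a : ℕ) * ψ (X 1) ^ i * ψ (X 2) ^ j ∈ M := by
    by_cases hi : i < q
    · by_cases hj : j < q
      · exact Submodule.subset_span ⟨(a, ⟨i, hi⟩, ⟨j, hj⟩), by simp⟩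
      · rw [pow_eq_zero_of_le (not_lt.1 hj) h2, mul_zero]
        exact M.zero_mem
    · rw [pow_eq_zero_of_le (not_lt.1 hi) h1, mul_zero, zero_mul]
      exact M.zero_mem
  have mem0 (i j : ℕ) : ψ (X 1) ^ i * ψ (X 2) ^ j ∈ M := by simpa using mem 0 i j
  have mem1 (i j : ℕ) : ψ (X 0) * ψ (X 1) ^ i * ψ (X 2) ^ j ∈ M := by simpa using mem 1 i j
  refine eq_top_of_forall_X_mul_mem ψ hψ M (by simpa using mem0 0 0) fun s y hy ↦ ?_
  induction hy using Submodule.span_induction with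
  | zero => rw [mul_zero]; exact M.zero_mem
  | add y z _ _ hy hz => rw [mul_add]; exact M.add_mem hy hz
  | smul a y _ hy => rw [mul_smul_comm]; exact M.smul_mem a hy
  | mem y hy =>
    obtain ⟨⟨a, i, j⟩, rfl⟩ := hy
    simp only [map_mul, map_pow]
    fin_cases s
    · fin_cases a
      · convert mem1 i j using 1
        simp
        ring
      · convert M.neg_mem (M.add_mem (mem0 (n + 1 + i) j) (mem0 (1 + i) (2 + j))) using 1
        simp
        linear_combination (ψ (X 1) ^ (i : ℕ) * ψ (X 2) ^ (j : ℕ)) * hrel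
    · convert mem a (i + 1) j using 1
      simp
      ring
    · convert mem a i (j + 1) using 1
      simp
      ring

/-- The coefficient of `ω ^ a * X 0 ^ i * X 1 ^ j`. -/
def quadraticCoeff (k : Type*) [Field k] (n : ℕ) (a : Fin 2) (m : Fin 2 →₀ ℕ) :
    QuadraticAlgebra (MvPolynomial (Fin 2) k) (-(X 0 ^ (n + 1) + X 0 * X 1 ^ 2)) 0 →ₗ[k] k where
  toFun z := (if a = 0 then z.re else z.im).coeff m
  map_add' z z' := by split_ifs <;> simp
  map_smul' c z := by split_ifs <;> simp

lemma quadraticCoeff_toQuadratic (n : ℕ) (a b : Fin 2) (i j : ℕ) (m : Fin 2 →₀ ℕ) :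
    quadraticCoeff k n a m (toQuadratic k n (X 0 ^ (b : ℕ) * X 1 ^ i * X 2 ^ j)) =
      if a = b ∧ Finsupp.single 0 i + Finsupp.single 1 j = m then 1 else 0 := by
  have h : toQuadratic k n (X 0 ^ (b : ℕ) * X 1 ^ i * X 2 ^ j) =
      QuadraticAlgebra.omega ^ (b : ℕ) *
        algebraMap (MvPolynomial (Fin 2) k) _
          (monomial (Finsupp.single 0 i + Finsupp.single 1 j) 1) := by
    rw [← one_mul (1 : k), ← monomial_mul, ← X_pow_eq_monomial, ← X_pow_eq_monomial]
    simp [toQuadratic, mul_assoc]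
  rw [h]
  fin_cases a <;> fin_cases b <;> simp [quadraticCoeff, coeff_monomial]

lemma finrank_eq_of_char_two (ψ : MvPolynomial (Fin 3) k →ₐ[k] Q) (hψ : Function.Surjective ψ)
    [CharP k 2] {n e : ℕ} (hn : 1 ≤ n)
    (hker : RingHom.ker ψ = Ideal.span {X 0 ^ 2 + X 1 ^ (n + 1) + X 1 * X 2 ^ 2,
      X 0 ^ 2 ^ (e + 1), X 1 ^ 2 ^ (e + 1), X 2 ^ 2 ^ (e + 1)}) :
    Module.finrank k Q = 2 * 4 ^ (e + 1) := by
  have hmem {f : MvPolynomial (Fin 3) k} (hf : f ∈ ({X 0 ^ 2 + X 1 ^ (n + 1) + X 1 * X 2 ^ 2,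
      X 0 ^ 2 ^ (e + 1), X 1 ^ 2 ^ (e + 1), X 2 ^ 2 ^ (e + 1)} :
      Set (MvPolynomial (Fin 3) k))) : ψ f = 0 := by
    rw [← RingHom.mem_ker, hker]; exact Ideal.subset_span hf
  have hrel := hmem (f := X 0 ^ 2 + X 1 ^ (n + 1) + X 1 * X 2 ^ 2) (by simp)
  simp only [map_add, map_mul, map_pow] at hrel
  have hcard : Fintype.card (Fin 2 × Fin (2 ^ (e + 1)) × Fin (2 ^ (e + 1))) =
      2 * 4 ^ (e + 1) := by
    rw [show 4 = 2 * 2 from rfl, mul_pow]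
    simp
  rw [← hcard]
  refine finrank_eq_card_of_dual ψ.toLinearMap
    (fun t ↦ X 0 ^ (t.1 : ℕ) * X 1 ^ (t.2.1 : ℕ) * X 2 ^ (t.2.2 : ℕ))
    (span_monomials_eq_top ψ hψ hrel (by rw [← map_pow]; exact hmem (by simp))
      (by rw [← map_pow]; exact hmem (by simp)))
    (fun t ↦ (quadraticCoeff k n t.1 (Finsupp.single 0 (t.2.1 : ℕ) +
      Finsupp.single 1 (t.2.2 : ℕ))).comp (toQuadratic k n).toLinearMap) ?_ ?_ ?_
  · rintro f hf ⟨a, i, j⟩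
    rw [AlgHom.toLinearMap_apply, ← RingHom.mem_ker, hker] at hf
    obtain ⟨hre, him⟩ := re_mem_and_im_mem_of_mem_map (toQuadratic_mem_of_mem_span hn hf)
    refine coeff_eq_zero_of_mem_span_pair (q := 2 ^ (e + 1)) ?_ (by simp) (by simp)
    split_ifs
    exacts [hre, him]
  · rintro ⟨a, i, j⟩
    simp only [LinearMap.comp_apply, AlgHom.toLinearMap_apply]
    rw [quadraticCoeff_toQuadratic, if_pos ⟨rfl, rfl⟩]
    exact one_ne_zero
  · rintro ⟨a, i, j⟩ ⟨b, i', j'⟩ hne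
    simp only [LinearMap.comp_apply, AlgHom.toLinearMap_apply]
    rw [quadraticCoeff_toQuadratic, if_neg]
    rintro ⟨rfl, h⟩
    have h0 := DFunLike.congr_fun h 0
    have h1 := DFunLike.congr_fun h 1
    simp at h0 h1
    exact hne (by rw [Fin.ext h0, Fin.ext h1])

end CharTwo

section Quotient

lemma finrank_quotient_quotient {k A : Type*} [Field k] [CommRing A] [Algebra k A] (I : Ideal A)
    (J : Ideal (A ⧸ I)) : Module.finrank k ((A ⧸ I) ⧸ J) =
      Module.finrank k (A ⧸ J.comap (Ideal.Quotient.mk I)) := by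
  have h : RingHom.ker ((Ideal.Quotient.mkₐ k J).comp (Ideal.Quotient.mkₐ k I)) =
      J.comap (Ideal.Quotient.mk I) := by
    ext f
    exact Ideal.Quotient.eq_zero_iff_mem
  have hsurj : Function.Surjective
      ((Ideal.Quotient.mkₐ k J).comp (Ideal.Quotient.mkₐ k I)) :=
    (Ideal.Quotient.mkₐ_surjective k J).comp (Ideal.Quotient.mkₐ_surjective k I)
  rw [← h]
  exact (Ideal.quotientKerAlgEquivOfSurjective hsurj).symm.toLinearEquiv.finrank_eq

lemma comap_span_pow_eq {k : Type*} [Field k] (n q : ℕ) :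
    (Ideal.span {Ideal.Quotient.mk (dnRel k n) (X 0) ^ q,
      Ideal.Quotient.mk (dnRel k n) (X 1) ^ q,
      Ideal.Quotient.mk (dnRel k n) (X 2) ^ q}).comap (Ideal.Quotient.mk (dnRel k n)) =
      Ideal.span {X 0 ^ 2 + X 1 ^ (n + 1) + X 1 * X 2 ^ 2, X 0 ^ q, X 1 ^ q, X 2 ^ q} := by
  have h : Ideal.span {Ideal.Quotient.mk (dnRel k n) (X 0) ^ q,
      Ideal.Quotient.mk (dnRel k n) (X 1) ^ q, Ideal.Quotient.mk (dnRel k n) (X 2) ^ q} =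
      (Ideal.span {X 0 ^ q, X 1 ^ q, X 2 ^ q}).map (Ideal.Quotient.mk (dnRel k n)) := by
    rw [Ideal.map_span]
    simp [Set.image_insert_eq]
  rw [h, Ideal.comap_map_of_surjective' _ Ideal.Quotient.mk_surjective, Ideal.mk_ker,
    sup_comm, dnRel, ← Ideal.span_union, Set.singleton_union]

end Quotient

/-- For `R = k[U,V,W]/(U²+V^{n+1}+VW²)` (type `D_{n+2}`, `n ≥ 2`) over an algebraically
closed field of characteristic `p`: if `p ∤ 4n`, then with `q = p^e` and
`r = q mod 2n`, `HKF(R,q) = (2 - 1/(4n))·q² - (r+1)/2 + r²/(4n)`;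
if `p = 2` and `e ≥ 1`, then `HKF(R,2^e) = 2·4^e`. -/
theorem stmt16 (k : Type*) [Field k] [IsAlgClosed k] (p : ℕ) (hp : p.Prime) [CharP k p]
    (n : ℕ) (hn : 2 ≤ n) :
    (¬ p ∣ 4 * n → ∀ e : ℕ,
      (Module.finrank k
          ((MvPolynomial (Fin 3) k ⧸ dnRel k n) ⧸
            Ideal.span {Ideal.Quotient.mk (dnRel k n) (X 0) ^ p ^ e,
              Ideal.Quotient.mk (dnRel k n) (X 1) ^ p ^ e,
              Ideal.Quotient.mk (dnRel k n) (X 2) ^ p ^ e}) : ℚ) =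
        (2 - 1 / (4 * (n : ℚ))) * (p : ℚ) ^ (2 * e)
          - (((p ^ e % (2 * n) : ℕ) : ℚ) + 1) / 2
          + ((p ^ e % (2 * n) : ℕ) : ℚ) ^ 2 / (4 * (n : ℚ))) ∧
    (p = 2 → ∀ e : ℕ, 1 ≤ e →
      (Module.finrank k
          ((MvPolynomial (Fin 3) k ⧸ dnRel k n) ⧸
            Ideal.span {Ideal.Quotient.mk (dnRel k n) (X 0) ^ p ^ e,
              Ideal.Quotient.mk (dnRel k n) (X 1) ^ p ^ e,
              Ideal.Quotient.mk (dnRel k n) (X 2) ^ p ^ e}) : ℚ) =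
        2 * (4 : ℚ) ^ e) := by
  refine ⟨fun hpn e ↦ ?_, ?_⟩
  · have hp2 : p ≠ 2 := by
      rintro rfl
      exact hpn (Dvd.dvd.mul_right (by norm_num) n)
    have h2 : (2 : k) ≠ 0 := Ring.two_ne_zero (by rwa [ringChar.eq k p])
    have hodd : Odd (p ^ e) := (hp.odd_of_ne_two hp2).pow
    obtain ⟨c, hc⟩ := IsAlgClosed.exists_pow_nat_eq (-1 : k) two_pos
    rw [finrank_quotient_quotient, comap_span_pow_eq,
      finrank_eq_card_basisIndex (Ideal.Quotient.mkₐ k _) (Ideal.Quotient.mkₐ_surjective k _)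
        h2 hp hodd (by omega) hc (Ideal.Quotient.mkₐ_ker k _),
      card_basisIndex_eq hn hodd, Nat.cast_pow, ← pow_mul, mul_comm e 2]
  · rintro rfl e he
    obtain ⟨e, rfl⟩ := Nat.exists_eq_add_of_le' he
    rw [finrank_quotient_quotient, comap_span_pow_eq,
      finrank_eq_of_char_two (Ideal.Quotient.mkₐ k _) (Ideal.Quotient.mkₐ_surjective k _)
        (by omega) (Ideal.Quotient.mkₐ_ker k _)]
    push_cast
    rfl
end
end

section
/- Let A_∞ = k[X,Y,Z]/(XY) (standard graded) over a field k of characteristic p > 0. Then for every q = p^e, there is an isomorphism Syz_{A_∞}(X^q, Y^q, Z^q) ≅ Syz_{A_∞}(X, Y, Z^q) up to degree shift, and consequently HKF(A_∞, q) = dim_k A_∞/(X^q,Y^q,Z^q) = 2q² - q. -/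
open MvPolynomial

set_option synthInstance.maxHeartbeats 1000000
set_option maxHeartbeats 1000000

noncomputable section

/-- The linear map sending a tuple `s` to `∑ i, s i * g i`. -/
def syzMap {R : Type*} [CommRing R] {N : ℕ} (g : Fin N → R) : (Fin N → R) →ₗ[R] R where
  toFun s := ∑ i, s i * g i
  map_add' := by intro s t; simp [add_mul, Finset.sum_add_distrib]
  map_smul' := by intro c s; simp [Finset.mul_sum, mul_assoc]

/-- The first syzygy module of `g 0, …, g (N-1)`. -/
def SyzOf {R : Type*} [CommRing R] {N : ℕ} (g : Fin N → R) : Submodule R (Fin N → R) :=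
  LinearMap.ker (syzMap g)

/-- `x ∈ A/I` is (the class of) a homogeneous polynomial of degree `j`
(standard grading, expressed by constant weights `1`). -/
def qhom {k : Type*} [Field k] {ν : ℕ} (w : Fin ν → ℤ) (I : Ideal (MvPolynomial (Fin ν) k))
    (j : ℤ) (x : MvPolynomial (Fin ν) k ⧸ I) : Prop :=
  ∃ P : MvPolynomial (Fin ν) k, IsWeightedHomogeneous w P j ∧ Ideal.Quotient.mk I P = x

theorem mem_span_pow_pow_mul_iff {k : Type*} [Field k] (q : ℕ) (f : MvPolynomial (Fin 3) k) :
    f ∈ Ideal.span {X 0 ^ q, X 1 ^ q, (X 0 * X 1 : MvPolynomial (Fin 3) k)} ↔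
      ∀ m ∈ f.support, q ≤ m 0 ∨ q ≤ m 1 ∨ (1 ≤ m 0 ∧ 1 ≤ m 1) := by
  have h : ({X 0 ^ q, X 1 ^ q, (X 0 * X 1 : MvPolynomial (Fin 3) k)} : Set _) =
      (fun s => monomial s (1 : k)) '' {Finsupp.single 0 q, Finsupp.single 1 q,
        Finsupp.single 0 1 + Finsupp.single 1 1} := by
    simp only [Set.image_insert_eq, Set.image_singleton, X_pow_eq_monomial]
    simp [X, monomial_mul]
  rw [h, mem_ideal_span_monomial_image]
  simp [Finsupp.le_def, Fin.forall_fin_succ]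

theorem mem_span_pow_pow_pow_mul_iff {k : Type*} [Field k] (q : ℕ)
    (f : MvPolynomial (Fin 3) k) :
    f ∈ Ideal.span {X 0 ^ q, X 1 ^ q, X 2 ^ q, (X 0 * X 1 : MvPolynomial (Fin 3) k)} ↔
      ∀ m ∈ f.support, q ≤ m 0 ∨ q ≤ m 1 ∨ q ≤ m 2 ∨ (1 ≤ m 0 ∧ 1 ≤ m 1) := by
  have h : ({X 0 ^ q, X 1 ^ q, X 2 ^ q, (X 0 * X 1 : MvPolynomial (Fin 3) k)} : Set _) =
      (fun s => monomial s (1 : k)) '' {Finsupp.single 0 q, Finsupp.single 1 q,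
        Finsupp.single 2 q, Finsupp.single 0 1 + Finsupp.single 1 1} := by
    simp only [Set.image_insert_eq, Set.image_singleton, X_pow_eq_monomial]
    simp [X, monomial_mul]
  rw [h, mem_ideal_span_monomial_image]
  simp [Finsupp.le_def, Fin.forall_fin_succ]

theorem mem_of_X_pow_mul_mem {k : Type*} [Field k] (q r : ℕ) (f : MvPolynomial (Fin 3) k)
    (h : X 2 ^ r * f ∈ Ideal.span {X 0 ^ q, X 1 ^ q, (X 0 * X 1 : MvPolynomial (Fin 3) k)}) :
    f ∈ Ideal.span {X 0 ^ q, X 1 ^ q, (X 0 * X 1 : MvPolynomial (Fin 3) k)} := by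
  rw [mem_span_pow_pow_mul_iff] at h ⊢
  intro m hm
  have := h (Finsupp.single 2 r + m) (by
    rw [mem_support_iff] at hm ⊢
    rwa [X_pow_eq_monomial, coeff_monomial_mul, one_mul])
  simpa using this

theorem X_mul_X_dvd_of_dvd_add_pow_mul {k : Type*} [Field k] (n : ℕ) (f : MvPolynomial (Fin 3) k)
    (h : X 0 * X 1 ∣ (X 0 + X 1) ^ n * f) : X 0 * X 1 ∣ f := by
  have hX (i : Fin 3) : Prime (X i : MvPolynomial (Fin 3) k) := X_prime
  have hne {i j : Fin 3} (hij : i ≠ j) : ¬ (X i : MvPolynomial (Fin 3) k) ∣ X j := by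
    rw [X_dvd_X]; simp [hij]
  have h0 : (X 0 : MvPolynomial (Fin 3) k) ∣ f := by
    refine ((hX 0).dvd_or_dvd ((dvd_mul_right _ _).trans h)).resolve_left fun h' => ?_
    exact hne (by decide) ((dvd_add_right (dvd_refl _)).1 ((hX 0).dvd_of_dvd_pow h'))
  have h1 : (X 1 : MvPolynomial (Fin 3) k) ∣ f := by
    refine ((hX 1).dvd_or_dvd ((dvd_mul_left _ _).trans h)).resolve_left fun h' => ?_
    exact hne (by decide) ((dvd_add_left (dvd_refl _)).1 ((hX 1).dvd_of_dvd_pow h'))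
  obtain ⟨g, rfl⟩ := h0
  exact mul_dvd_mul_left _ (((hX 1).dvd_or_dvd h1).resolve_left (hne (by decide)))

theorem mul_add_pow_of_mul_eq_zero {R : Type*} [CommRing R] {x y : R} (h : x * y = 0) (n : ℕ) :
    x * (x + y) ^ n = x ^ (n + 1) := by
  induction n with
  | zero => simp
  | succ n ih =>
    rw [pow_succ, ← mul_assoc, ih, mul_add, pow_succ x n, mul_assoc _ x y, h]
    ring

theorem isWeightedHomogeneous_X_add_X_pow {k : Type*} [Field k] (n : ℕ) :
    IsWeightedHomogeneous (fun _ : Fin 3 => (1 : ℤ))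
      ((X 0 + X 1 : MvPolynomial (Fin 3) k) ^ n) (n : ℤ) := by
  simpa using ((isWeightedHomogeneous_X k (fun _ : Fin 3 => (1 : ℤ)) 0).add
    (isWeightedHomogeneous_X k (fun _ : Fin 3 => (1 : ℤ)) 1)).pow n

section Graded

attribute [local instance] weightedGradedAlgebra

theorem weightedHomogeneousComponent_mul_of_left {k σ M : Type*} [CommSemiring k]
    [AddCancelCommMonoid M] {w : σ → M} {W : MvPolynomial σ k} {m : M}
    (hW : IsWeightedHomogeneous w W m) (P : MvPolynomial σ k) (d : M) :
    weightedHomogeneousComponent w (m + d) (W * P) =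
      W * weightedHomogeneousComponent w d P := by
  classical
  have := DirectSum.coe_decompose_mul_add_of_left_mem (weightedHomogeneousSubmodule k w)
    (i := m) (j := d) (a := W) (b := P) hW
  rwa [← decompose'_apply, ← decompose'_apply]

theorem isHomogeneous_span_X_mul_X {k : Type*} [Field k] :
    (Ideal.span {(X 0 * X 1 : MvPolynomial (Fin 3) k)}).IsHomogeneous
      (weightedHomogeneousSubmodule k (fun _ : Fin 3 => (1 : ℤ))) := by
  refine Ideal.homogeneous_span _ _ ?_
  rintro _ rfl
  exact ⟨1 + 1, (isWeightedHomogeneous_X k (fun _ : Fin 3 => (1 : ℤ)) 0).mul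
    (isWeightedHomogeneous_X k (fun _ : Fin 3 => (1 : ℤ)) 1)⟩

theorem eq_zero_of_add_pow_mul_eq_zero {k : Type*} [Field k] (n : ℕ)
    (c : MvPolynomial (Fin 3) k ⧸ Ideal.span {(X 0 * X 1 : MvPolynomial (Fin 3) k)})
    (h : (Ideal.Quotient.mk _ (X 0) + Ideal.Quotient.mk _ (X 1)) ^ n * c = 0) : c = 0 := by
  obtain ⟨P, rfl⟩ := Ideal.Quotient.mk_surjective c
  rw [← map_add, ← map_pow, ← map_mul, Ideal.Quotient.eq_zero_iff_dvd] at h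
  rw [Ideal.Quotient.eq_zero_iff_dvd]
  exact X_mul_X_dvd_of_dvd_add_pow_mul n P h

theorem qhom_add_pow_mul_iff {k : Type*} [Field k] (n : ℕ) (d : ℤ)
    (c : MvPolynomial (Fin 3) k ⧸ Ideal.span {(X 0 * X 1 : MvPolynomial (Fin 3) k)}) :
    qhom (fun _ => (1 : ℤ)) _ (n + d)
        ((Ideal.Quotient.mk _ (X 0) + Ideal.Quotient.mk _ (X 1)) ^ n * c) ↔
      qhom (fun _ => (1 : ℤ)) _ d c := by
  constructor
  · rintro ⟨Q, hQ, h⟩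
    obtain ⟨P, rfl⟩ := Ideal.Quotient.mk_surjective c
    refine ⟨weightedHomogeneousComponent (fun _ => (1 : ℤ)) d P,
      weightedHomogeneousComponent_isWeightedHomogeneous _ _, ?_⟩
    have hmem := weightedHomogeneousComponent_mem_of_mem k _ isHomogeneous_span_X_mul_X
      (Ideal.Quotient.eq.1 (h.trans (by rw [map_mul, map_pow, map_add] :
        _ = Ideal.Quotient.mk _ ((X 0 + X 1) ^ n * P)))) ((n : ℤ) + d)
    rw [map_sub, weightedHomogeneousComponent_mul_of_left (isWeightedHomogeneous_X_add_X_pow n),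
      hQ.weightedHomogeneousComponent_same] at hmem
    have h' := (Ideal.Quotient.eq.2 hmem).symm.trans h
    rw [map_mul, map_pow, map_add] at h'
    exact sub_eq_zero.1 (eq_zero_of_add_pow_mul_eq_zero n _ (by rw [mul_sub, h', sub_self]))
  · rintro ⟨P, hP, rfl⟩
    exact ⟨(X 0 + X 1) ^ n * P, (isWeightedHomogeneous_X_add_X_pow n).mul hP, by simp⟩

end Graded

theorem mem_syzOf_fin_three {R : Type*} [CommRing R] (a b c : R) (s : Fin 3 → R) :
    s ∈ SyzOf ![a, b, c] ↔ s 0 * a + s 1 * b + s 2 * c = 0 := by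
  simp [SyzOf, syzMap, Fin.sum_univ_three]

/-- Multiplying the last entry by `(x + y) ^ n` turns a syzygy of `x, y, z` into
one of `x ^ (n + 1), y ^ (n + 1), z`, provided that `x * y = 0`. -/
def syzMulAddPow {R : Type*} [CommRing R] {x y : R} (h : x * y = 0) (z : R) (n : ℕ) :
    SyzOf ![x, y, z] →ₗ[R] SyzOf ![x ^ (n + 1), y ^ (n + 1), z] where
  toFun s := ⟨![s.1 0, s.1 1, (x + y) ^ n * s.1 2], by
    have hs := (mem_syzOf_fin_three _ _ _ _).1 s.2
    rw [mem_syzOf_fin_three, ← mul_add_pow_of_mul_eq_zero h,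
      ← mul_add_pow_of_mul_eq_zero (x := y) (y := x) (by rwa [mul_comm]), add_comm y x]
    simp only [Matrix.cons_val]
    linear_combination (x + y) ^ n * hs⟩
  map_add' s t := by ext i; fin_cases i <;> simp [mul_add]
  map_smul' r s := by ext i; fin_cases i <;> simp [mul_left_comm]

theorem exists_eq_add_pow_mul {k : Type*} [Field k] (n r : ℕ)
    (a b c : MvPolynomial (Fin 3) k ⧸ Ideal.span {(X 0 * X 1 : MvPolynomial (Fin 3) k)})
    (h : a * Ideal.Quotient.mk _ (X 0) ^ (n + 1) + b * Ideal.Quotient.mk _ (X 1) ^ (n + 1) +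
      c * Ideal.Quotient.mk _ (X 2) ^ r = 0) :
    ∃ c', c = (Ideal.Quotient.mk _ (X 0) + Ideal.Quotient.mk _ (X 1)) ^ n * c' := by
  have hxy : Ideal.Quotient.mk (Ideal.span {(X 0 * X 1 : MvPolynomial (Fin 3) k)}) (X 0) *
      Ideal.Quotient.mk _ (X 1) = 0 := by
    rw [← map_mul, Ideal.Quotient.eq_zero_iff_dvd]
  obtain ⟨a, rfl⟩ := Ideal.Quotient.mk_surjective a
  obtain ⟨b, rfl⟩ := Ideal.Quotient.mk_surjective b
  obtain ⟨c, rfl⟩ := Ideal.Quotient.mk_surjective c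
  simp only [← map_mul, ← map_pow, ← map_add] at h
  rw [Ideal.Quotient.eq_zero_iff_dvd] at h
  obtain ⟨g, hg⟩ := h
  have hc := mem_of_X_pow_mul_mem (n + 1) r c (by
    rw [Ideal.mem_span_insert']
    refine ⟨a, ?_⟩
    rw [Ideal.mem_span_pair]
    exact ⟨-b, g, by linear_combination -hg⟩)
  rw [Ideal.mem_span_insert] at hc
  obtain ⟨u, t, ht, rfl⟩ := hc
  obtain ⟨v, w, rfl⟩ := Ideal.mem_span_pair.1 ht
  refine ⟨Ideal.Quotient.mk _ u * Ideal.Quotient.mk _ (X 0) +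
    Ideal.Quotient.mk _ v * Ideal.Quotient.mk _ (X 1), ?_⟩
  have hx := mul_add_pow_of_mul_eq_zero hxy n
  have hy := mul_add_pow_of_mul_eq_zero ((mul_comm _ _).trans hxy) n
  rw [add_comm] at hy
  simp only [map_add, map_mul, map_pow]
  linear_combination (-Ideal.Quotient.mk _ u) * hx - Ideal.Quotient.mk _ v * hy +
    Ideal.Quotient.mk _ w * hxy

theorem syzMulAddPow_bijective {k : Type*} [Field k] (n r : ℕ)
    (hxy : Ideal.Quotient.mk (Ideal.span {(X 0 * X 1 : MvPolynomial (Fin 3) k)}) (X 0) *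
      Ideal.Quotient.mk _ (X 1) = 0) :
    Function.Bijective (syzMulAddPow hxy (Ideal.Quotient.mk _ (X 2) ^ r) n) := by
  constructor
  · rw [← LinearMap.ker_eq_bot, LinearMap.ker_eq_bot']
    intro s hs
    have h (i) := congrFun (congrArg Subtype.val hs) i
    ext i
    fin_cases i
    · exact h 0
    · exact h 1
    · exact eq_zero_of_add_pow_mul_eq_zero n _ (h 2)
  · rintro ⟨s, hs⟩
    have hs' := (mem_syzOf_fin_three _ _ _ _).1 hs
    obtain ⟨c, hc⟩ := exists_eq_add_pow_mul n r _ _ _ hs'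
    refine ⟨⟨![s 0, s 1, c], ?_⟩, ?_⟩
    · rw [mem_syzOf_fin_three]
      refine eq_zero_of_add_pow_mul_eq_zero n _ ?_
      have hx := mul_add_pow_of_mul_eq_zero hxy n
      have hy := mul_add_pow_of_mul_eq_zero ((mul_comm _ _).trans hxy) n
      rw [add_comm] at hy
      rw [← hx, ← hy, hc] at hs'
      simp only [Matrix.cons_val]
      linear_combination hs'
    · ext i
      fin_cases i
      · rfl
      · rfl
      · exact hc.symm

/-- The exponents of the monomials outside `(X ^ (n + 1), Y ^ (n + 1), Z ^ (n + 1), X * Y)`. -/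
def standardExponent (n : ℕ) (t : (Fin (n + 1) ⊕ Fin n) × Fin (n + 1)) : Fin 3 →₀ ℕ :=
  Finsupp.equivFunOnFinite.symm
    ![t.1.elim (fun a : Fin (n + 1) => (a : ℕ)) (fun _ => 0),
      t.1.elim (fun _ => 0) (fun b : Fin n => (b : ℕ) + 1), t.2]

theorem standardExponent_injective (n : ℕ) : Function.Injective (standardExponent n) := by
  intro s t h
  have h0 := DFunLike.congr_fun h 0
  have h1 := DFunLike.congr_fun h 1
  have h2 := DFunLike.congr_fun h 2
  obtain ⟨a | a, c⟩ := s <;> obtain ⟨b | b, d⟩ := t <;>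
    simp_all [standardExponent, Fin.val_inj]

theorem mem_range_standardExponent (n : ℕ) (m : Fin 3 →₀ ℕ) :
    m ∈ Set.range (standardExponent n) ↔
      ¬ (n + 1 ≤ m 0 ∨ n + 1 ≤ m 1 ∨ n + 1 ≤ m 2 ∨ (1 ≤ m 0 ∧ 1 ≤ m 1)) := by
  constructor
  · rintro ⟨⟨a | a, c⟩, rfl⟩ <;> simp [standardExponent] <;> omega
  · intro h
    push Not at h
    obtain ⟨h0, h1, h2, h3⟩ := h
    by_cases hm : m 1 = 0
    · refine ⟨(Sum.inl ⟨m 0, h0⟩, ⟨m 2, h2⟩), ?_⟩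
      ext i; fin_cases i <;> simp [standardExponent, hm]
    · refine ⟨(Sum.inr ⟨m 1 - 1, by omega⟩, ⟨m 2, h2⟩), ?_⟩
      ext i; fin_cases i <;> simp [standardExponent] <;> omega

/-- The coefficients of a polynomial at the standard monomials. -/
def standardCoeff (k : Type*) [Field k] (n : ℕ) :
    MvPolynomial (Fin 3) k →ₗ[k] ((Fin (n + 1) ⊕ Fin n) × Fin (n + 1) → k) :=
  LinearMap.pi fun t => lcoeff k (standardExponent n t)

theorem standardCoeff_surjective (k : Type*) [Field k] (n : ℕ) :
    Function.Surjective (standardCoeff k n) := by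
  classical
  intro g
  refine ⟨∑ t, monomial (standardExponent n t) (g t), ?_⟩
  ext t
  simp [standardCoeff, coeff_monomial, (standardExponent_injective n).eq_iff]

theorem standardCoeff_eq_zero_iff {k : Type*} [Field k] (n : ℕ) (f : MvPolynomial (Fin 3) k) :
    standardCoeff k n f = 0 ↔ f ∈ Ideal.span {X 0 ^ (n + 1), X 1 ^ (n + 1), X 2 ^ (n + 1),
      (X 0 * X 1 : MvPolynomial (Fin 3) k)} := by
  rw [mem_span_pow_pow_pow_mul_iff, funext_iff]
  constructor
  · intro h m hm
    by_contra hm'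
    obtain ⟨t, rfl⟩ := (mem_range_standardExponent n m).2 hm'
    exact mem_support_iff.1 hm (h t)
  · intro h t
    by_contra ht
    exact (mem_range_standardExponent n _).1 ⟨t, rfl⟩ (h _ (mem_support_iff.2 ht))

theorem finrank_quotient_span_pow {k : Type*} [Field k] (n : ℕ)
    (I : Ideal (MvPolynomial (Fin 3) k)) (hI : I = Ideal.span {X 0 * X 1}) :
    Module.finrank k ((MvPolynomial (Fin 3) k ⧸ I) ⧸ Ideal.span
      {Ideal.Quotient.mk I (X 0) ^ (n + 1), Ideal.Quotient.mk I (X 1) ^ (n + 1),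
        Ideal.Quotient.mk I (X 2) ^ (n + 1)}) = 2 * (n + 1) ^ 2 - (n + 1) := by
  set J := Ideal.span {Ideal.Quotient.mk I (X 0) ^ (n + 1), Ideal.Quotient.mk I (X 1) ^ (n + 1),
        Ideal.Quotient.mk I (X 2) ^ (n + 1)} with hJ
  let π : MvPolynomial (Fin 3) k →ₗ[k] (MvPolynomial (Fin 3) k ⧸ I) ⧸ J :=
    ((Ideal.Quotient.mkₐ k J).comp (Ideal.Quotient.mkₐ k I)).toLinearMap
  have hπ : Function.Surjective π :=
    Ideal.Quotient.mk_surjective.comp Ideal.Quotient.mk_surjective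
  have hker : LinearMap.ker π = LinearMap.ker (standardCoeff k n) := by
    ext f
    have hJmap : J = (Ideal.span {X 0 ^ (n + 1), X 1 ^ (n + 1), X 2 ^ (n + 1)}).map
        (Ideal.Quotient.mk I) := by
      simp [hJ, Ideal.map_span, Set.image_insert_eq]
    rw [LinearMap.mem_ker, LinearMap.mem_ker, standardCoeff_eq_zero_iff]
    change Ideal.Quotient.mk J (Ideal.Quotient.mk I f) = 0 ↔ _
    rw [Ideal.Quotient.eq_zero_iff_mem, hJmap, Ideal.mem_quotient_iff_mem_sup, hI,
      ← Ideal.span_union]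
    simp only [Set.insert_union, Set.singleton_union]
  rw [← (LinearMap.quotKerEquivOfSurjective π hπ).finrank_eq, hker,
    (LinearMap.quotKerEquivOfSurjective _ (standardCoeff_surjective k n)).finrank_eq,
    Module.finrank_fintype_fun_eq_card]
  simp only [Fintype.card_prod, Fintype.card_sum, Fintype.card_fin]
  refine Nat.eq_sub_of_add_eq ?_
  ring

/-- Let `A_∞ = k[X,Y,Z]/(XY)` (standard graded) over a field of characteristic `p > 0`,
and `q = p^e`.  Then `Syz_{A_∞}(X^q, Y^q, Z^q) ≅ Syz_{A_∞}(X, Y, Z^q)` up to degree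
shift (a graded isomorphism after a shift `c`), and consequently
`HKF(A_∞, q) = dim_k A_∞/(X^q,Y^q,Z^q) = 2q² - q`. -/
theorem stmt18 (k : Type*) [Field k] (p : ℕ) (hp : p.Prime) [CharP k p] (e : ℕ) :
    ∀ I : Ideal (MvPolynomial (Fin 3) k), I = Ideal.span {X 0 * X 1} →
    ∀ x y z : MvPolynomial (Fin 3) k ⧸ I,
      x = Ideal.Quotient.mk I (X 0) → y = Ideal.Quotient.mk I (X 1) →
      z = Ideal.Quotient.mk I (X 2) →
      (∃ (c : ℤ)
          (φ : SyzOf ![x ^ p ^ e, y ^ p ^ e, z ^ p ^ e] ≃ₗ[MvPolynomial (Fin 3) k ⧸ I]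
            SyzOf ![x, y, z ^ p ^ e]),
        ∀ (t : ℤ) (s : SyzOf ![x ^ p ^ e, y ^ p ^ e, z ^ p ^ e]),
          (∀ i, qhom (fun _ => (1 : ℤ)) I (t - ![(p ^ e : ℤ), (p ^ e : ℤ), (p ^ e : ℤ)] i)
            (s.1 i)) ↔
          (∀ i, qhom (fun _ => (1 : ℤ)) I (t + c - ![(1 : ℤ), 1, (p ^ e : ℤ)] i)
            ((φ s).1 i))) ∧
      Module.finrank k
          ((MvPolynomial (Fin 3) k ⧸ I) ⧸ Ideal.span {x ^ p ^ e, y ^ p ^ e, z ^ p ^ e}) =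
        2 * (p ^ e) ^ 2 - p ^ e := by
  rintro I rfl x y z rfl rfl rfl
  obtain ⟨n, hn⟩ : ∃ n, p ^ e = n + 1 := Nat.exists_eq_succ_of_ne_zero (pow_pos hp.pos e).ne'
  have hn' : (p : ℤ) ^ e = n + 1 := by exact_mod_cast hn
  rw [hn, hn']
  refine ⟨⟨-n, ?_⟩, finrank_quotient_span_pow n _ rfl⟩
  have hxy : Ideal.Quotient.mk (Ideal.span {(X 0 * X 1 : MvPolynomial (Fin 3) k)}) (X 0) *
      Ideal.Quotient.mk _ (X 1) = 0 := by
    rw [← map_mul, Ideal.Quotient.eq_zero_iff_dvd]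
  let ψ := LinearEquiv.ofBijective _ (syzMulAddPow_bijective n (n + 1) hxy)
  refine ⟨ψ.symm, fun t s => ?_⟩
  obtain ⟨s, rfl⟩ := ψ.surjective s
  rw [ψ.symm_apply_apply]
  have h0 : (ψ s).1 0 = s.1 0 := rfl
  have h1 : (ψ s).1 1 = s.1 1 := rfl
  have h2 : (ψ s).1 2 = _ * s.1 2 := rfl
  have hd : t - ((n : ℤ) + 1) = t + -n - 1 := by ring
  have hd' : t - ((n : ℤ) + 1) = n + (t + -n - (n + 1)) := by ring
  simp only [Fin.forall_fin_succ, Fin.isValue, Fin.succ_zero_eq_one, Fin.succ_one_eq_two,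
    Matrix.cons_val, h0, h1, h2, IsEmpty.forall_iff, and_true]
  rw [← qhom_add_pow_mul_iff n (t + -n - (n + 1)), ← hd', ← hd]
end
end
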